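/- arXiv:1307.6683 — 5 statements merged into one kernel-verified Lean document; each statement's English description precedes it below -/
import Mathlib

section
/- Let I ⊆ ℝ be an interval, let x : I → [0,∞) be continuous, let Ψ : ℝ → [0,∞) be continuous, let β > 0 be a constant, and let ω : [0,∞) → (0,∞) be continuous and non-decreasing. Fix u₀ ≥ 0 and define Φ(u) := ∫_{u₀}^{u} ds/ω(s). If for all t, t' ∈ I with t < t' one has x(t') − x(t) ≤ β ∫_t^{t'} Ψ(s) ω(x(s)) ds, then for all t, t' ∈ I with t < t' one has Φ(x(t')) − Φ(x(t)) ≤ β ∫_t^{t'} Ψ(s) ds. -/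
open Set Filter MeasureTheory

/-- **Bihari's inequality** on a compact interval, for globally continuous data. -/
theorem bihari_of_continuous {x Ψ ω : ℝ → ℝ} {β a b : ℝ} (u₀ : ℝ) (hab : a ≤ b)
    (hx : Continuous x) (hΨ : Continuous Ψ) (hΨnn : ∀ s, 0 ≤ Ψ s) (hβ : 0 ≤ β)
    (hω : Continuous ω) (hωpos : ∀ s, 0 < ω s) (hωmono : Monotone ω)
    (hmain : ∀ s ∈ Icc a b, x s - x a ≤ β * ∫ r in a..s, Ψ r * ω (x r)) :
    (∫ s in u₀..(x b), 1 / ω s) - (∫ s in u₀..(x a), 1 / ω s) ≤ β * ∫ s in a..b, Ψ s := by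
  have hω' : Continuous fun s => 1 / ω s :=
    continuous_const.div hω fun s => (hωpos s).ne'
  set Φ : ℝ → ℝ := fun u => ∫ s in u₀..u, 1 / ω s with hΦ
  set y : ℝ → ℝ := fun s => x a + β * ∫ r in a..s, Ψ r * ω (x r) with hy
  have hΦd : ∀ u, HasDerivAt Φ (1 / ω u) u := fun u => hω'.integral_hasStrictDerivAt u₀ u
    |>.hasDerivAt
  have hyd : ∀ s, HasDerivAt y (β * (Ψ s * ω (x s))) s := fun s =>
    ((((hΨ.mul (hω.comp hx)).integral_hasStrictDerivAt a s).hasDerivAt).const_mul β).const_add _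
  have hΨd : ∀ s, HasDerivAt (fun s => β * ∫ r in a..s, Ψ r) (β * Ψ s) s := fun s =>
    ((hΨ.integral_hasStrictDerivAt a s).hasDerivAt).const_mul β
  have hd : ∀ s, HasDerivAt (fun s => Φ (y s) - β * ∫ r in a..s, Ψ r)
      (1 / ω (y s) * (β * (Ψ s * ω (x s))) - β * Ψ s) s := fun s =>
    ((hΦd (y s)).comp s (hyd s)).sub (hΨd s)
  have hxy : ∀ s ∈ Icc a b, x s ≤ y s := fun s hs => by
    linarith [hmain s hs]
  have hanti : AntitoneOn (fun s => Φ (y s) - β * ∫ r in a..s, Ψ r) (Icc a b) := by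
    refine antitoneOn_of_deriv_nonpos (convex_Icc a b)
      (fun s _ => (hd s).continuousAt.continuousWithinAt)
      (fun s _ => (hd s).differentiableAt.differentiableWithinAt) fun s hs => ?_
    have hle : ω (x s) / ω (y s) ≤ 1 :=
      (div_le_one (hωpos _)).2 (hωmono (hxy s (interior_subset hs)))
    have hmul := mul_le_mul_of_nonneg_left hle (mul_nonneg hβ (hΨnn s))
    rw [(hd s).deriv]
    calc _ = β * Ψ s * (ω (x s) / ω (y s)) - β * Ψ s := by ring
      _ ≤ 0 := by linarith
  have hΦmono : Monotone Φ := monotone_of_deriv_nonneg (fun u => (hΦd u).differentiableAt)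
    fun u => by rw [(hΦd u).deriv]; exact (one_div_pos.2 (hωpos u)).le
  have hend := hanti (left_mem_Icc.2 hab) (right_mem_Icc.2 hab) hab
  have hya : y a = x a := by simp [hy]
  simp only [hya, intervalIntegral.integral_same, mul_zero, sub_zero] at hend
  have hb := hΦmono (hxy b (right_mem_Icc.2 hab))
  change Φ (x b) - Φ (x a) ≤ _
  linarith

/-- **LaSalle–Bihari generalization of Gronwall's inequality (plus version).**
If `x : I → [0,∞)` is continuous on the interval `I`, `Ψ ≥ 0` is continuous,
`β > 0`, `ω : [0,∞) → (0,∞)` is continuous and non-decreasing, and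
`x(t') - x(t) ≤ β ∫_t^{t'} Ψ(s) ω(x(s)) ds` for all `t < t'` in `I`, then with
`Φ(u) = ∫_{u₀}^u ds/ω(s)` one has `Φ(x(t')) - Φ(x(t)) ≤ β ∫_t^{t'} Ψ(s) ds`. -/
theorem lasalle_bihari_plus (I : Set ℝ) (hI : I.OrdConnected)
    (x Ψ ω : ℝ → ℝ) (β u₀ : ℝ)
    (hx : ContinuousOn x I) (hxnn : ∀ t ∈ I, 0 ≤ x t)
    (hΨ : Continuous Ψ) (hΨnn : ∀ s, 0 ≤ Ψ s)
    (hβ : 0 < β)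
    (hω : ContinuousOn ω (Ici 0)) (hωpos : ∀ s ∈ Ici (0:ℝ), 0 < ω s)
    (hωmono : MonotoneOn ω (Ici 0))
    (hu₀ : 0 ≤ u₀)
    (hmain : ∀ t ∈ I, ∀ t' ∈ I, t < t' →
      x t' - x t ≤ β * ∫ s in t..t', Ψ s * ω (x s)) :
    ∀ t ∈ I, ∀ t' ∈ I, t < t' →
      (∫ s in u₀..(x t'), 1 / ω s) - (∫ s in u₀..(x t), 1 / ω s)
        ≤ β * ∫ s in t..t', Ψ s := by
  intro a ha b hb hab
  have hsub : Icc a b ⊆ I := hI.out ha hb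
  set X : ℝ → ℝ := IccExtend hab.le ((Icc a b).domRestrict x) with hXdef
  have hX : Continuous X := (hx.mono hsub).domRestrict.Icc_extend'
  have hXeq : ∀ s ∈ Icc a b, X s = x s := fun s hs => by
    simp [hXdef, IccExtend_of_mem hab.le _ hs]
  set W : ℝ → ℝ := fun s => ω (max s 0) with hW
  have hWeq : ∀ s, 0 ≤ s → W s = ω s := fun s hs => by simp [hW, max_eq_left hs]
  have hWc : Continuous W := hω.comp_continuous (by fun_prop) fun s => le_max_right s 0
  have hWm : Monotone W := fun s r h =>
    hωmono (le_max_right s 0) (le_max_right r 0) (max_le_max_right 0 h)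
  have hΦeq : ∀ u, 0 ≤ u → ∫ s in u₀..u, 1 / W s = ∫ s in u₀..u, 1 / ω s := fun u hu =>
    intervalIntegral.integral_congr fun s hs => by
      simp only [hWeq s ((le_min hu₀ hu).trans hs.1)]
  have key := bihari_of_continuous u₀ hab.le hX hΨ hΨnn hβ.le hWc
    (fun s => hωpos _ (le_max_right s 0)) hWm fun s hs => by
      have hint : ∫ r in a..s, Ψ r * W (X r) = ∫ r in a..s, Ψ r * ω (x r) :=
        intervalIntegral.integral_congr fun r hr => by
          rw [uIcc_of_le hs.1] at hr
          have hr' : r ∈ Icc a b := ⟨hr.1, hr.2.trans hs.2⟩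
          simp only [hXeq r hr', hWeq _ (hxnn r (hsub hr'))]
      rw [hint, hXeq s hs, hXeq a (left_mem_Icc.2 hab.le)]
      rcases hs.1.eq_or_lt with rfl | has
      · simp
      · exact hmain a ha s (hsub hs) has
  rwa [hXeq a (left_mem_Icc.2 hab.le), hXeq b (right_mem_Icc.2 hab.le),
    hΦeq _ (hxnn a ha), hΦeq _ (hxnn b hb)] at key
end

section
/- Let ν : ℝ × ℝⁿ → ℝⁿ be continuous, and suppose that for every r > 0 there exists a continuous non-decreasing function g_r : [1,∞) → [1,∞) with ∫₁^∞ dx/(x g_r(x)) = +∞ such that ‖ν(t,q)‖ ≤ g_r(1 + ‖q‖) · (1 + ‖q‖) for every (t,q) ∈ [−r,r] × ℝⁿ. Then every maximal solution of the ordinary differential equation q̇(t) = ν(t, q(t)) is defined on all of ℝ. (A solution q : I → ℝⁿ, with I an interval, is maximal if it admits no extension to a solution on a strictly larger interval.) -/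
open Set Filter MeasureTheory

/-- A solution of the first order ODE `q̇ = ν(t, q)` on a nonempty interval `I ⊆ ℝ`. -/
def IsSolutionFO {n : ℕ} (ν : ℝ → EuclideanSpace ℝ (Fin n) → EuclideanSpace ℝ (Fin n))
    (I : Set ℝ) (q : ℝ → EuclideanSpace ℝ (Fin n)) : Prop :=
  I.Nonempty ∧ I.OrdConnected ∧ ∀ t ∈ I, HasDerivWithinAt q (ν t (q t)) I t

/-- A maximal solution: a solution admitting no extension to a solution on a
strictly larger interval. -/
def IsMaximalSolutionFO {n : ℕ} (ν : ℝ → EuclideanSpace ℝ (Fin n) → EuclideanSpace ℝ (Fin n))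
    (I : Set ℝ) (q : ℝ → EuclideanSpace ℝ (Fin n)) : Prop :=
  IsSolutionFO ν I q ∧
    ∀ J r, IsSolutionFO ν J r → I ⊆ J → Set.EqOn q r I → J = I

open Topology

section Peano

variable {E : Type*} [NormedAddCommGroup E] [NormedSpace ℝ E]

/-- The explicit Euler scheme with step `h` for `q̇ = f(t, q)`, `q(t₀) = x₀`. -/
noncomputable def eulerSeq (f : ℝ → E → E) (t₀ : ℝ) (x₀ : E) (h : ℝ) : ℕ → E
  | 0 => x₀
  | l + 1 => eulerSeq f t₀ x₀ h l + h • f (t₀ + l * h) (eulerSeq f t₀ x₀ h l)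

lemma norm_eulerSeq_sub_sub_smul_le {f : ℝ → E → E} {t₀ : ℝ} {x₀ : E} {h : ℝ} (hh : 0 ≤ h)
    {v : E} {ε : ℝ} {i j : ℕ} (hij : i ≤ j)
    (H : ∀ l, i ≤ l → l < j → ‖f (t₀ + l * h) (eulerSeq f t₀ x₀ h l) - v‖ ≤ ε) :
    ‖eulerSeq f t₀ x₀ h j - eulerSeq f t₀ x₀ h i - (((j : ℝ) - i) * h) • v‖
      ≤ ((j : ℝ) - i) * h * ε := by
  induction j, hij using Nat.le_induction with
  | base => simp
  | succ j hij ih =>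
    have h₁ := ih fun l hl hlj => H l hl (by omega)
    have h₂ : ‖h • (f (t₀ + j * h) (eulerSeq f t₀ x₀ h j) - v)‖ ≤ h * ε := by
      rw [norm_smul, Real.norm_of_nonneg hh]
      exact mul_le_mul_of_nonneg_left (H j hij (by omega)) hh
    have h₃ : eulerSeq f t₀ x₀ h (j + 1) - eulerSeq f t₀ x₀ h i - (((j + 1 : ℕ) - (i : ℝ)) * h) • v
        = (eulerSeq f t₀ x₀ h j - eulerSeq f t₀ x₀ h i - (((j : ℝ) - i) * h) • v)
          + h • (f (t₀ + j * h) (eulerSeq f t₀ x₀ h j) - v) := by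
      rw [eulerSeq]
      push_cast
      module
    rw [h₃]
    refine (norm_add_le _ _).trans ((add_le_add h₁ h₂).trans_eq ?_)
    push_cast
    ring

lemma norm_eulerSeq_sub_le {f : ℝ → E → E} {M : ℝ} (hM : ∀ t x, ‖f t x‖ ≤ M) {t₀ : ℝ} {x₀ : E}
    {h : ℝ} (hh : 0 ≤ h) (i j : ℕ) :
    ‖eulerSeq f t₀ x₀ h j - eulerSeq f t₀ x₀ h i‖ ≤ |((j : ℝ) - i) * h| * M := by
  wlog hij : i ≤ j generalizing i j
  · rw [norm_sub_rev, ← abs_neg, ← neg_mul, neg_sub]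
    exact this j i (by omega)
  have hij' : (i : ℝ) ≤ j := by exact_mod_cast hij
  rw [abs_of_nonneg (mul_nonneg (by linarith) hh)]
  simpa using norm_eulerSeq_sub_sub_smul_le (f := f) (t₀ := t₀) (x₀ := x₀) hh (v := 0) hij
    fun l _ _ => by simpa using hM _ _

/-- Forward Peano existence theorem for bounded continuous right-hand sides: a pointwise
ultrafilter limit of Euler approximations is a solution. -/
theorem exists_hasDerivWithinAt_Ici_of_bounded [ProperSpace E] {f : ℝ → E → E}
    (hf : Continuous fun p : ℝ × E => f p.1 p.2) {M : ℝ} (hM : ∀ t x, ‖f t x‖ ≤ M)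
    (t₀ : ℝ) (x₀ : E) :
    ∃ q : ℝ → E, q t₀ = x₀ ∧ ∀ t ∈ Ici t₀, HasDerivWithinAt q (f t (q t)) (Ici t₀) t := by
  have hM₀ : 0 ≤ M := (norm_nonneg _).trans (hM t₀ x₀)
  set U : Ultrafilter ℕ := Ultrafilter.of atTop
  have hU : (U : Filter ℕ) ≤ atTop := Ultrafilter.of_le atTop
  set h : ℕ → ℝ := fun k => 1 / ((k : ℝ) + 1)
  have hpos : ∀ k, 0 < h k := fun k => Nat.one_div_pos_of_nat
  have hlim : Tendsto h U (𝓝 0) := tendsto_one_div_add_atTop_nhds_zero_nat.mono_left hU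
  set N : ℕ → ℝ → ℕ := fun k t => ⌊(t - t₀) / h k⌋₊
  have hN₁ : ∀ k, ∀ t ∈ Ici t₀, N k t * h k ≤ t - t₀ := fun k t ht => by
    rw [← le_div_iff₀ (hpos k)]
    exact Nat.floor_le (div_nonneg (sub_nonneg.2 ht) (hpos k).le)
  have hN₂ : ∀ k t, t - t₀ < (N k t + 1) * h k := fun k t => by
    rw [← div_lt_iff₀ (hpos k)]
    exact Nat.lt_floor_add_one _
  set y : ℕ → ℕ → E := fun k => eulerSeq f t₀ x₀ (h k)
  have hex : ∀ t, ∃ x, t₀ ≤ t → Tendsto (fun k => y k (N k t)) U (𝓝 x) := fun t => by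
    by_cases ht : t₀ ≤ t
    · have hb : Tendsto (fun k => y k (N k t)) U (𝓟 (Metric.closedBall x₀ ((t - t₀) * M))) := by
        refine tendsto_principal.2 (Eventually.of_forall fun k => ?_)
        rw [mem_closedBall_iff_norm]
        refine (norm_eulerSeq_sub_le hM (hpos k).le 0 (N k t)).trans ?_
        have := hN₁ k t ht
        have h₀ : 0 ≤ N k t * h k := mul_nonneg (Nat.cast_nonneg _) (hpos k).le
        rw [Nat.cast_zero, sub_zero, abs_of_nonneg h₀]
        gcongr
      obtain ⟨x, -, hx⟩ := (isCompact_closedBall x₀ ((t - t₀) * M)).ultrafilter_le_nhds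
        (U.map fun k => y k (N k t)) hb
      exact ⟨x, fun _ => hx⟩
    · exact ⟨x₀, fun h => absurd h ht⟩
  choose q hq using hex
  refine ⟨q, ?_, fun t ht => ?_⟩
  · refine tendsto_nhds_unique (hq t₀ le_rfl) ?_
    simp [N, y, eulerSeq]
  set v := f t (q t)
  rw [hasDerivWithinAt_iff_isLittleO, Asymptotics.isLittleO_iff]
  intro ε hε
  obtain ⟨η, hη, hcont⟩ := Metric.continuousAt_iff.1 (hf.continuousAt (x := (t, q t))) ε hε
  obtain ⟨δ, hδ, hδη, hδM⟩ : ∃ δ > 0, δ < η / 4 ∧ M * δ < η / 4 := by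
    refine ⟨η / (8 * (M + 1)), by positivity, ?_, ?_⟩
    · rw [div_lt_div_iff₀ (by positivity) (by positivity)]; nlinarith
    · rw [← mul_div_assoc, div_lt_div_iff₀ (by positivity) (by positivity)]; nlinarith
  have key : ∀ s s', t₀ ≤ s → s ≤ s' → t - δ ≤ s → s' ≤ t + δ →
      ‖q s' - q s - (s' - s) • v‖ ≤ (s' - s) * ε := by
    intro s s' hs hss' hsδ hs'δ
    have hs' := hs.trans hss'
    have hev : ∀ᶠ k in (U : Filter ℕ), ‖y k (N k s') - y k (N k s) - (s' - s) • v‖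
        ≤ (s' - s + h k) * ε + h k * ‖v‖ := by
      have hsmall : ∀ᶠ k in (U : Filter ℕ), 2 * h k < η / 4 :=
        (hlim.const_mul 2).eventually_lt_const (by simpa using hη)
      have hsmallM : ∀ᶠ k in (U : Filter ℕ), M * (2 * h k) < η / 4 :=
        ((hlim.const_mul 2).const_mul M).eventually_lt_const (by simpa using hη)
      have hnear : ∀ᶠ k in (U : Filter ℕ), dist (y k (N k t)) (q t) < η / 4 :=
        (hq t ht).eventually (Metric.ball_mem_nhds _ (by positivity))
      filter_upwards [hsmall, hsmallM, hnear] with k hk hkM hkt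
      have a₁ := hN₁ k s hs
      have a₂ := hN₂ k s
      have b₁ := hN₁ k s' hs'
      have b₂ := hN₂ k s'
      have c₁ := hN₁ k t ht
      have c₂ := hN₂ k t
      have hk₀ := hpos k
      have hmono : N k s ≤ N k s' := by
        apply Nat.floor_mono
        gcongr
      have hstep := norm_eulerSeq_sub_sub_smul_le (f := f) (t₀ := t₀) (x₀ := x₀) hk₀.le
        (v := v) (ε := ε) hmono (fun l hl hl' => by
          have hl₁ : (N k s : ℝ) * h k ≤ l * h k := by gcongr
          have hl₂ : ((l : ℝ) + 1) * h k ≤ N k s' * h k := by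
            gcongr
            exact_mod_cast hl'
          have hd : |((l : ℝ) - N k t) * h k| ≤ δ + 2 * h k := by
            rw [abs_le]
            constructor <;> linarith
          have hy := norm_eulerSeq_sub_le hM (t₀ := t₀) (x₀ := x₀) hk₀.le (N k t) l
          have hy' : dist (y k l) (y k (N k t)) < η / 2 := by
            rw [dist_eq_norm]
            have := mul_le_mul_of_nonneg_right hd hM₀
            linarith
          have hy'' := dist_triangle (y k l) (y k (N k t)) (q t)
          have := hcont (x := (t₀ + l * h k, y k l)) (by
            rw [Prod.dist_eq, max_lt_iff]
            refine ⟨?_, by simp only; linarith⟩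
            rw [Real.dist_eq, abs_lt]
            constructor <;> simp only <;> linarith)
          rw [dist_eq_norm] at this
          exact this.le)
      have herr : ‖(((N k s' : ℝ) - N k s) * h k - (s' - s)) • v‖ ≤ h k * ‖v‖ := by
        rw [norm_smul]
        gcongr
        rw [Real.norm_eq_abs, abs_le]
        constructor <;> linarith
      have hsplit : y k (N k s') - y k (N k s) - (s' - s) • v
          = (y k (N k s') - y k (N k s) - (((N k s' : ℝ) - N k s) * h k) • v)
            + (((N k s' : ℝ) - N k s) * h k - (s' - s)) • v := by module
      rw [hsplit]
      refine (norm_add_le _ _).trans (add_le_add (hstep.trans ?_) herr)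
      gcongr
      linarith
    have hl := (((hq s' hs').sub (hq s hs)).sub_const ((s' - s) • v)).norm
    have hr : Tendsto (fun k => (s' - s + h k) * ε + h k * ‖v‖) U (𝓝 ((s' - s) * ε)) := by
      simpa using ((hlim.const_add (s' - s)).mul_const ε).add (hlim.mul_const ‖v‖)
    exact le_of_tendsto_of_tendsto hl hr hev
  have hnhds : Ici t₀ ∩ Icc (t - δ) (t + δ) ∈ 𝓝[Ici t₀] t :=
    inter_mem self_mem_nhdsWithin
      (mem_nhdsWithin_of_mem_nhds (Icc_mem_nhds (by linarith) (by linarith)))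
  filter_upwards [hnhds] with s ⟨hs, hsδ⟩
  rcases le_total t s with hts | hst
  · rw [Real.norm_of_nonneg (sub_nonneg.2 hts), mul_comm]
    exact key t s ht hts (by linarith) hsδ.2
  · have := key s t hs hst hsδ.1 (by linarith)
    rw [Real.norm_eq_abs, abs_sub_comm, abs_of_nonneg (sub_nonneg.2 hst), mul_comm, ← norm_neg]
    have hneg : -(q s - q t - (s - t) • v) = q t - q s - (t - s) • v := by module
    rwa [hneg]

/-- Forward local Peano existence theorem. -/
theorem exists_hasDerivWithinAt_Icc_of_continuous [ProperSpace E] {f : ℝ → E → E}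
    (hf : Continuous fun p : ℝ × E => f p.1 p.2) (t₀ : ℝ) (x₀ : E) :
    ∃ q : ℝ → E, q t₀ = x₀ ∧ ∃ t₁ > t₀, ∀ t ∈ Icc t₀ t₁,
      HasDerivWithinAt q (f t (q t)) (Icc t₀ t₁) t := by
  set M : ℝ := ‖f t₀ x₀‖ + 1
  have hM : 0 < M := by positivity
  have hmax : ∀ t x, 0 < max M ‖f t x‖ := fun t x => hM.trans_le (le_max_left _ _)
  have hcut : Continuous fun p : ℝ × E => (M / max M ‖f p.1 p.2‖) • f p.1 p.2 :=
    Continuous.smul (continuous_const.div (continuous_const.max hf.norm)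
      fun p => (hmax p.1 p.2).ne') hf
  obtain ⟨q, hq₀, hq⟩ := exists_hasDerivWithinAt_Ici_of_bounded
    (f := fun t x => (M / max M ‖f t x‖) • f t x) hcut (M := M) (fun t x => by
        have := hmax t x
        rw [norm_smul, Real.norm_of_nonneg (by positivity), div_mul_eq_mul_div, div_le_iff₀ this]
        gcongr
        exact le_max_right _ _) t₀ x₀
  have hc : ContinuousWithinAt (fun t => ‖f t (q t)‖) (Ici t₀) t₀ :=
    hf.norm.continuousAt.comp_continuousWithinAt (f := fun t => (t, q t))
      (continuousWithinAt_id.prodMk (hq t₀ self_mem_Ici).continuousWithinAt)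
  have hlt : ∀ᶠ t in 𝓝[≥] t₀, ‖f t (q t)‖ < M :=
    hc.eventually_lt_const (by simp only [hq₀]; exact lt_add_one _)
  obtain ⟨t₁, ht₁, hsub⟩ := mem_nhdsGE_iff_exists_Icc_subset.1 hlt
  refine ⟨q, hq₀, t₁, ht₁, fun t ht => ?_⟩
  have := (hq t ht.1).mono (Icc_subset_Ici_self : Icc t₀ t₁ ⊆ Ici t₀)
  have hle : ‖f t (q t)‖ ≤ M := (hsub ht).le
  simpa [max_eq_left hle, div_self hM.ne'] using this

end Peano

/-- A curve on a bounded interval whose speed is controlled by a gauge function is bounded. -/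
lemma exists_norm_le_of_norm_deriv_le_gauge {F : Type*} [NormedAddCommGroup F]
    [InnerProductSpace ℝ F] {g : ℝ → ℝ} (hgc : ContinuousOn g (Ici 1))
    (hgm : MonotoneOn g (Ici 1)) (hg₁ : ∀ x ∈ Ici (1 : ℝ), 1 ≤ g x)
    (hG : Tendsto (fun y => ∫ x in (1 : ℝ)..y, 1 / (x * g x)) atTop atTop)
    {s : Set ℝ} (hs : Convex ℝ s) (hb : Bornology.IsBounded s) {q q' : ℝ → F}
    (hq : ∀ t ∈ s, HasDerivWithinAt q (q' t) s t)
    (hq' : ∀ t ∈ s, ‖q' t‖ ≤ g (1 + ‖q t‖) * (1 + ‖q t‖)) :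
    ∃ R, ∀ t ∈ s, ‖q t‖ ≤ R := by
  rcases s.eq_empty_or_nonempty with rfl | ⟨c, hc⟩
  · simp
  set G : ℝ → ℝ := fun y => ∫ x in (1 : ℝ)..y, 1 / (x * g x)
  set u : ℝ → ℝ := fun t => √(1 + ‖q t‖ ^ 2)
  have hu₀ : ∀ t, 0 < u t := fun t => Real.sqrt_pos.2 (by positivity)
  have hu : ∀ t, ‖q t‖ ≤ u t := fun t => Real.le_sqrt_of_sq_le (by linarith)
  have hcont : ContinuousOn (fun x => 1 / (x * g x)) (Ici 1) :=
    continuousOn_const.div (continuousOn_id.mul hgc) fun x hx => by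
      have h₁ := hg₁ x hx
      have h₂ : (1 : ℝ) ≤ x := hx
      exact (mul_pos (zero_lt_one.trans_le h₂) (zero_lt_one.trans_le h₁)).ne'
  have hGd : ∀ w, 1 < w → HasDerivAt G (1 / (w * g w)) w := fun w hw => by
    refine intervalIntegral.integral_hasDerivAt_right ?_ ?_ (hcont.continuousAt (Ici_mem_nhds hw))
    · refine (hcont.mono ?_).intervalIntegrable
      rw [uIcc_of_le hw.le]
      exact Icc_subset_Ici_self
    · exact (hcont.mono Ioi_subset_Ici_self).stronglyMeasurableAtFilter isOpen_Ioi w hw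
  have hud : ∀ t ∈ s, HasDerivWithinAt u (inner ℝ (q t) (q' t) / u t) s t := fun t ht => by
    convert ((hq t ht).norm_sq.const_add 1).sqrt (by positivity) using 1
    rw [mul_div_mul_left _ _ two_ne_zero]
  have hΦ : ∀ t ∈ s, HasDerivWithinAt (fun t => G (1 + u t))
      (1 / ((1 + u t) * g (1 + u t)) * (inner ℝ (q t) (q' t) / u t)) s t := fun t ht =>
    (hGd _ (by linarith [hu₀ t])).comp_hasDerivWithinAt t ((hud t ht).const_add 1)
  have hΦ₁ : ∀ t ∈ s, ‖1 / ((1 + u t) * g (1 + u t)) * (inner ℝ (q t) (q' t) / u t)‖ ≤ 1 := by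
    intro t ht
    have h₁ : (1 : ℝ) ≤ 1 + ‖q t‖ := by linarith [norm_nonneg (q t)]
    have h₂ : 1 + ‖q t‖ ≤ 1 + u t := by linarith [hu t]
    have hg₀ : 0 < g (1 + u t) := zero_lt_one.trans_le (hg₁ _ (h₁.trans h₂))
    have hpos : 0 < (1 + u t) * g (1 + u t) := mul_pos (by linarith) hg₀
    have hi : ‖inner ℝ (q t) (q' t) / u t‖ ≤ (1 + u t) * g (1 + u t) := by
      rw [norm_div, Real.norm_of_nonneg (hu₀ t).le, div_le_iff₀ (hu₀ t)]
      calc ‖inner ℝ (q t) (q' t)‖ ≤ ‖q t‖ * ‖q' t‖ := norm_inner_le_norm _ _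
        _ ≤ u t * (g (1 + u t) * (1 + u t)) := by
          gcongr
          · exact hu t
          · refine (hq' t ht).trans ?_
            gcongr
            exact hgm h₁ (h₁.trans h₂) h₂
        _ = (1 + u t) * g (1 + u t) * u t := by ring
    rw [norm_mul, Real.norm_of_nonneg (by positivity), one_div_mul_eq_div, div_le_one hpos]
    exact hi
  obtain ⟨r, hr⟩ := hb.subset_closedBall c
  obtain ⟨Y, hY⟩ := (hG.eventually_gt_atTop (G (1 + u c) + r)).exists_forall_of_atTop
  refine ⟨Y, fun t ht => ?_⟩
  have hle := hs.norm_image_sub_le_of_norm_hasDerivWithin_le hΦ hΦ₁ hc ht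
  have hd : ‖t - c‖ ≤ r := mem_closedBall_iff_norm.1 (hr ht)
  by_contra! hlt
  have h₁ := hY (1 + u t) (by linarith [hu t])
  have h₂ := (Real.le_norm_self _).trans hle
  simp only [G] at h₁ h₂
  linarith

section MaximalSolution

variable {n : ℕ} {ν : ℝ → EuclideanSpace ℝ (Fin n) → EuclideanSpace ℝ (Fin n)} {I : Set ℝ}
  {q : ℝ → EuclideanSpace ℝ (Fin n)}

lemma IsSolutionFO.comp_neg (h : IsSolutionFO ν I q) :
    IsSolutionFO (fun t x => -ν (-t) x) (-I) fun t => q (-t) := by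
  obtain ⟨hne, hoc, hd⟩ := h
  refine ⟨hne.neg, ⟨fun x hx y hy z hz => ?_⟩, fun t ht => ?_⟩
  · exact hoc.out hy hx ⟨neg_le_neg hz.2, neg_le_neg hz.1⟩
  · have h := (hd (-t) ht).scomp t (hasDerivAt_neg t).hasDerivWithinAt (s := -I) fun x hx => hx
    rwa [neg_one_smul] at h

lemma IsMaximalSolutionFO.comp_neg (h : IsMaximalSolutionFO ν I q) :
    IsMaximalSolutionFO (fun t x => -ν (-t) x) (-I) fun t => q (-t) := by
  refine ⟨h.1.comp_neg, fun J r hr hJ he => ?_⟩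
  have hr' := hr.comp_neg
  simp only [neg_neg] at hr'
  rw [← h.2 (-J) _ hr' (fun t ht => hJ (by simpa using ht))
    (fun t ht => by simpa using he (x := -t) (by simpa using ht)), neg_neg]

lemma IsSolutionFO.insert_of_isLUB (h : IsSolutionFO ν I q)
    (hν : Continuous fun p : ℝ × EuclideanSpace ℝ (Fin n) => ν p.1 p.2) {b : ℝ} (hb : IsLUB I b)
    (hbI : b ∉ I) {x : EuclideanSpace ℝ (Fin n)} (hx : Tendsto q (𝓝[I] b) (𝓝 x)) :
    IsSolutionFO ν (insert b I) (Function.update q b x) := by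
  obtain ⟨⟨c, hc⟩, hoc, hd⟩ := h
  have hlt : ∀ t ∈ I, t < b := fun t ht => (hb.1 ht).lt_of_ne fun h => hbI (h ▸ ht)
  have hsub : ∀ t ∈ I, Ico t b ⊆ I := fun t ht s hs => by
    obtain ⟨s', hs', hss', -⟩ := hb.exists_between hs.2
    exact hoc.out ht hs' ⟨hs.1, hss'.le⟩
  have hcb := hlt c hc
  have heq : EqOn (Function.update q b x) q I := fun t ht =>
    Function.update_of_ne (hlt t ht).ne _ _
  have hdI : ∀ t ∈ I, HasDerivWithinAt (Function.update q b x)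
      (ν t (Function.update q b x t)) I t := fun t ht => by
    rw [heq ht]
    exact (hd t ht).congr heq (heq ht)
  have hIoo : Ioo c b ⊆ I := Ioo_subset_Ico_self.trans (hsub c hc)
  have hdo : ∀ t ∈ Ioo c b, HasDerivAt (Function.update q b x)
      (ν t (Function.update q b x t)) t := fun t ht =>
    (hdI t (hIoo ht)).hasDerivAt (mem_of_superset (Ioo_mem_nhds ht.1 ht.2) hIoo)
  have hcont : ContinuousWithinAt (Function.update q b x) (Ioo c b) b := by
    rw [continuousWithinAt_update_same]
    exact hx.mono_left (nhdsWithin_mono _ (sdiff_subset.trans hIoo))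
  have hdb : HasDerivWithinAt (Function.update q b x) (ν b (Function.update q b x b)) (Iic b) b := by
    refine hasDerivWithinAt_Iic_of_tendsto_deriv (s := Ioo c b)
      (fun t ht => (hdo t ht).differentiableAt.differentiableWithinAt) hcont
      (Ioo_mem_nhdsLT hcb) ?_
    rw [← nhdsWithin_Ioo_eq_nhdsLT hcb]
    have := hν.continuousAt.comp_continuousWithinAt (f := fun t => (t, Function.update q b x t))
      (continuousWithinAt_id.prodMk hcont)
    refine Tendsto.congr' ?_ this
    filter_upwards [self_mem_nhdsWithin] with t ht using (hdo t ht).deriv.symm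
  refine ⟨insert_nonempty _ _, ⟨fun s hs t ht z hz => ?_⟩, fun t ht => ?_⟩
  · have hzb : z ≤ b := hz.2.trans (by
      rcases ht with rfl | ht
      exacts [le_rfl, hb.1 ht])
    rcases hzb.eq_or_lt with rfl | hzb
    · exact mem_insert _ _
    · rcases hs with rfl | hs
      · exact absurd hz.1 hzb.not_ge
      · exact mem_insert_of_mem _ (hsub s hs ⟨hz.1, hzb⟩)
  · rcases ht with rfl | ht
    · exact hdb.mono (insert_subset self_mem_Iic fun t ht => hb.1 ht)
    · refine (hdI t ht).mono_of_mem_nhdsWithin ?_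
      filter_upwards [self_mem_nhdsWithin,
        mem_nhdsWithin_of_mem_nhds (Iio_mem_nhds (hlt t ht))] with s hs hsb
      exact hs.resolve_left (ne_of_lt hsb)

lemma IsSolutionFO.exists_extension_of_isGreatest (h : IsSolutionFO ν I q)
    (hν : Continuous fun p : ℝ × EuclideanSpace ℝ (Fin n) => ν p.1 p.2) {b : ℝ}
    (hb : IsGreatest I b) :
    ∃ b' > b, ∃ r, IsSolutionFO ν (I ∪ Icc b b') r ∧ EqOn q r I := by
  obtain ⟨-, hoc, hd⟩ := h
  obtain ⟨p, hp₀, b', hb', hp⟩ := exists_hasDerivWithinAt_Icc_of_continuous hν b (q b)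
  set r : ℝ → EuclideanSpace ℝ (Fin n) := fun t => if t ≤ b then q t else p t
  have hrq : EqOn r q I := fun t ht => if_pos (hb.2 ht)
  have hrp : EqOn r p (Icc b b') := fun t ht => by
    rcases ht.1.eq_or_lt with rfl | hlt
    · rw [hrq hb.1, hp₀]
    · exact if_neg hlt.not_ge
  have hdI : ∀ t ∈ I, HasDerivWithinAt r (ν t (r t)) I t := fun t ht => by
    rw [hrq ht]
    exact (hd t ht).congr hrq (hrq ht)
  have hdIcc : ∀ t ∈ Icc b b', HasDerivWithinAt r (ν t (r t)) (Icc b b') t := fun t ht => by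
    rw [hrp ht]
    exact (hp t ht).congr hrp (hrp ht)
  have hbIcc : b ∈ Icc b b' := left_mem_Icc.2 hb'.le
  refine ⟨b', hb', r, ⟨⟨b, Or.inl hb.1⟩, ⟨fun s hs t ht z hz => ?_⟩, fun t ht => ?_⟩, hrq.symm⟩
  · rcases le_total z b with hzb | hbz
    · rcases hs with hs | hs
      · exact Or.inl (hoc.out hs hb.1 ⟨hz.1, hzb⟩)
      · exact Or.inr ⟨hs.1.trans hz.1, hzb.trans hb'.le⟩
    · rcases ht with ht | ht
      · exact Or.inl (hoc.out hb.1 ht ⟨hbz, hz.2⟩)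
      · exact Or.inr ⟨hbz, hz.2.trans ht.2⟩
  · rcases lt_trichotomy t b with htb | rfl | hbt
    · refine (hdI t (ht.resolve_right fun h => htb.not_ge h.1)).mono_of_mem_nhdsWithin ?_
      filter_upwards [self_mem_nhdsWithin,
        mem_nhdsWithin_of_mem_nhds (Iio_mem_nhds htb)] with s hs hsb
      exact hs.resolve_right fun h => (mem_Iio.1 hsb).not_ge h.1
    · exact (hdI t hb.1).union (hdIcc t hbIcc)
    · refine (hdIcc t (ht.resolve_left fun h => hbt.not_ge (hb.2 h))).mono_of_mem_nhdsWithin ?_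
      filter_upwards [self_mem_nhdsWithin,
        mem_nhdsWithin_of_mem_nhds (Ioi_mem_nhds hbt)] with s hs hsb
      exact hs.resolve_left fun h => (mem_Ioi.1 hsb).not_ge (hb.2 h)

lemma IsMaximalSolutionFO.not_bddAbove
    (hν : Continuous fun p : ℝ × EuclideanSpace ℝ (Fin n) => ν p.1 p.2)
    (hbound : ∀ r > (0:ℝ), ∃ g : ℝ → ℝ,
      ContinuousOn g (Ici 1) ∧ MonotoneOn g (Ici 1) ∧ (∀ x ∈ Ici (1:ℝ), 1 ≤ g x) ∧
      Tendsto (fun y => ∫ x in (1:ℝ)..y, 1 / (x * g x)) atTop atTop ∧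
      ∀ t ∈ Icc (-r) r, ∀ x : EuclideanSpace ℝ (Fin n),
        ‖ν t x‖ ≤ g (1 + ‖x‖) * (1 + ‖x‖))
    (hq : IsMaximalSolutionFO ν I q) : ¬BddAbove I := by
  intro hbdd
  obtain ⟨b, hb⟩ : ∃ b, IsLUB I b := ⟨_, isLUB_csSup hq.1.1 hbdd⟩
  by_cases hbI : b ∈ I
  · obtain ⟨b', hb', r, hr, he⟩ := hq.1.exists_extension_of_isGreatest hν ⟨hbI, hb.1⟩
    have hJ := hq.2 _ r hr subset_union_left he
    have hb'I : b' ∈ I := hJ ▸ Or.inr (right_mem_Icc.2 hb'.le)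
    exact hb'.not_ge (hb.1 hb'I)
  obtain ⟨⟨c, hc⟩, hoc, hd⟩ := hq.1
  obtain ⟨g, hgc, hgm, hg₁, hG, hg⟩ := hbound (|b| + |c| + 1) (by positivity)
  have hcb : c ≤ b := hb.1 hc
  set s : Set ℝ := I ∩ Icc c b
  have hsr : ∀ t ∈ s, t ∈ Icc (-(|b| + |c| + 1)) (|b| + |c| + 1) := fun t ht => by
    constructor
    · linarith [neg_abs_le c, ht.2.1, abs_nonneg b]
    · linarith [le_abs_self b, ht.2.2, abs_nonneg c]
  have hs : Convex ℝ s := hoc.convex.inter (convex_Icc _ _)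
  have hds : ∀ t ∈ s, HasDerivWithinAt q (ν t (q t)) s t := fun t ht =>
    (hd t ht.1).mono inter_subset_left
  obtain ⟨R, hR⟩ := exists_norm_le_of_norm_deriv_le_gauge hgc hgm hg₁ hG hs
    ((Metric.isBounded_Icc c b).subset inter_subset_right) hds fun t ht => hg t (hsr t ht) _
  have hM : ∀ t ∈ s, ‖ν t (q t)‖ ≤ g (1 + R) * (1 + R) := fun t ht => by
    have h₁ : (1 : ℝ) ≤ 1 + ‖q t‖ := by linarith [norm_nonneg (q t)]
    have h₂ : 1 + ‖q t‖ ≤ 1 + R := by linarith [hR t ht]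
    have h₃ := hg₁ _ (h₁.trans h₂)
    refine (hg t (hsr t ht) _).trans ?_
    gcongr
    exact hgm h₁ (h₁.trans h₂) h₂
  have hlip : LipschitzOnWith (g (1 + R) * (1 + R)).toNNReal q s :=
    hs.lipschitzOnWith_of_nnnorm_hasDerivWithin_le hds fun t ht =>
      NNReal.coe_le_coe.1 ((hM t ht).trans (Real.le_coe_toNNReal _))
  obtain ⟨x, hx⟩ : ∃ x, Tendsto q (𝓝[I] b) (𝓝 x) := by
    have hcb' : c < b := hcb.lt_of_ne fun h => hbI (by rwa [← h])
    have heq : 𝓝[I] b = 𝓝[s] b := by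
      refine le_antisymm ?_ (nhdsWithin_mono _ inter_subset_left)
      refine le_inf nhdsWithin_le_nhds (le_principal_iff.2 ?_)
      filter_upwards [self_mem_nhdsWithin, mem_nhdsWithin_of_mem_nhds (Ioi_mem_nhds hcb')]
        with t ht htc using ⟨ht, le_of_lt htc, hb.1 ht⟩
    have : (𝓝[I] b).NeBot := mem_closure_iff_nhdsWithin_neBot.1 (hb.mem_closure ⟨c, hc⟩)
    have hcauchy : Cauchy (map q (𝓝[I] b)) :=
      (cauchy_nhds.mono nhdsWithin_le_nhds).map_of_le hlip.uniformContinuousOn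
        (heq.trans_le inf_le_right)
    exact CompleteSpace.complete hcauchy
  have hJ := hq.2 _ _ (hq.1.insert_of_isLUB hν hb hbI hx) (subset_insert _ _) fun t ht =>
    (Function.update_of_ne (fun h => hbI (by rwa [← h])) _ _).symm
  exact hbI (hJ ▸ mem_insert _ _)

end MaximalSolution

/-- **Wintner's completeness theorem for first-order ODE flows on `ℝⁿ`.**
If `ν` is continuous and for every `r > 0` there is a gauge function `g_r`
(continuous, non-decreasing, `≥ 1`, with `∫₁^∞ dx/(x g_r(x)) = +∞`) such that
`‖ν(t,q)‖ ≤ g_r(1 + ‖q‖)(1 + ‖q‖)` on `[-r,r] × ℝⁿ`, then every maximal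
solution of `q̇ = ν(t,q)` is defined on all of `ℝ`. -/
theorem wintner_first_order_completeness {n : ℕ}
    (ν : ℝ → EuclideanSpace ℝ (Fin n) → EuclideanSpace ℝ (Fin n))
    (hν : Continuous fun p : ℝ × EuclideanSpace ℝ (Fin n) => ν p.1 p.2)
    (hbound : ∀ r > (0:ℝ), ∃ g : ℝ → ℝ,
      ContinuousOn g (Ici 1) ∧ MonotoneOn g (Ici 1) ∧ (∀ x ∈ Ici (1:ℝ), 1 ≤ g x) ∧
      Tendsto (fun y => ∫ x in (1:ℝ)..y, 1 / (x * g x)) atTop atTop ∧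
      ∀ t ∈ Icc (-r) r, ∀ x : EuclideanSpace ℝ (Fin n),
        ‖ν t x‖ ≤ g (1 + ‖x‖) * (1 + ‖x‖))
    (I : Set ℝ) (q : ℝ → EuclideanSpace ℝ (Fin n))
    (hq : IsMaximalSolutionFO ν I q) : I = Set.univ := by
  have habove := hq.not_bddAbove hν hbound
  have hbelow := hq.comp_neg.not_bddAbove
    (hν.comp (continuous_fst.neg.prodMk continuous_snd)).neg (fun r hr => by
      obtain ⟨g, hgc, hgm, hg₁, hG, hg⟩ := hbound r hr
      refine ⟨g, hgc, hgm, hg₁, hG, fun t ht x => ?_⟩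
      rw [norm_neg]
      exact hg (-t) ⟨neg_le_neg ht.2, by linarith [ht.1]⟩ x)
  rw [bddAbove_neg] at hbelow
  refine eq_univ_of_forall fun t => ?_
  obtain ⟨s, hs, hst⟩ := not_bddBelow_iff.1 hbelow t
  obtain ⟨s', hs', hts'⟩ := not_bddAbove_iff.1 habove t
  exact hq.1.2.1.out hs hs' ⟨hst.le, hts'.le⟩
end

section
/- Let g : [1,∞) → [1,∞) be a continuous non-decreasing function with G(y) := ∫₁^y dx/(x g(x)) → +∞ as y → +∞, let ν : ℝ × ℝⁿ → ℝⁿ be continuous with ‖ν(t,q)‖ ≤ g(1 + ‖q‖) · (1 + ‖q‖) for all (t,q) ∈ [t₀,t₁] × ℝⁿ, and let q : [t₀,t₁] → ℝⁿ be a C¹ solution of q̇(t) = ν(t, q(t)). Then for all t ∈ [t₀,t₁] one has 1 + ‖q(t)‖ ≤ G⁻¹( G(1 + ‖q(t₀)‖) + (t − t₀) ), where G⁻¹ : [0,∞) → [1,∞) is the inverse of G. In particular q is bounded on [t₀,t₁]. -/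
open Set Filter MeasureTheory

theorem continuousOn_one_div_mul_gauge {g : ℝ → ℝ} (hgc : ContinuousOn g (Ici 1))
    (hg1 : ∀ x ∈ Ici (1 : ℝ), 1 ≤ g x) :
    ContinuousOn (fun x => 1 / (x * g x)) (Ici 1) := by
  refine continuousOn_const.div (continuousOn_id.mul hgc) fun x hx => ?_
  have hg := hg1 x hx
  rw [mem_Ici] at hx
  exact (mul_pos (by simpa using by linarith) (by linarith)).ne'

theorem hasDerivAt_integral_one_div_mul_gauge {g : ℝ → ℝ} (hgc : ContinuousOn g (Ici 1))
    (hg1 : ∀ x ∈ Ici (1 : ℝ), 1 ≤ g x) {y : ℝ} (hy : 1 < y) :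
    HasDerivAt (fun y => ∫ x in (1 : ℝ)..y, 1 / (x * g x)) (1 / (y * g y)) y := by
  have hc := continuousOn_one_div_mul_gauge hgc hg1
  refine intervalIntegral.integral_hasDerivAt_right ?_ ?_ (hc.continuousAt (Ici_mem_nhds hy))
  · refine ContinuousOn.intervalIntegrable (hc.mono ?_)
    rw [uIcc_of_le hy.le]
    exact Icc_subset_Ici_self
  · exact (hc.mono Ioi_subset_Ici_self).stronglyMeasurableAtFilter isOpen_Ioi y hy

theorem integral_one_div_mul_gauge_nonneg {g : ℝ → ℝ} (hg1 : ∀ x ∈ Ici (1 : ℝ), 1 ≤ g x)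
    {y : ℝ} (hy : 1 ≤ y) : 0 ≤ ∫ x in (1 : ℝ)..y, 1 / (x * g x) := by
  refine intervalIntegral.integral_nonneg hy fun x hx => ?_
  have hg := hg1 x hx.1
  have hx1 := hx.1
  have : 0 ≤ x * g x := mul_nonneg (by linarith) (by linarith)
  positivity

/-- The inverse of `G(y) = ∫₁^y dx/(x g(x))` solves `w' = w g(w)` on `(0,∞)`. -/
theorem hasDerivAt_inverse_integral_gauge {g Ginv : ℝ → ℝ} (hgc : ContinuousOn g (Ici 1))
    (hg1 : ∀ x ∈ Ici (1 : ℝ), 1 ≤ g x)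
    (hGinvmap : MapsTo Ginv (Ici 0) (Ici 1)) (hGinvmono : MonotoneOn Ginv (Ici 0))
    (hGinv₁ : ∀ y ∈ Ici (1 : ℝ), Ginv (∫ x in (1 : ℝ)..y, 1 / (x * g x)) = y)
    (hGinv₂ : ∀ z ∈ Ici (0 : ℝ), (∫ x in (1 : ℝ)..(Ginv z), 1 / (x * g x)) = z)
    {z : ℝ} (hz : 0 < z) :
    HasDerivAt Ginv (Ginv z * g (Ginv z)) z := by
  have hlt : 1 < Ginv z := by
    refine lt_of_le_of_ne (hGinvmap hz.le) fun h => hz.ne ?_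
    have := hGinv₂ z hz.le
    rwa [← h, intervalIntegral.integral_same] at this
  have hcont : ContinuousAt Ginv z := by
    refine continuousAt_of_monotoneOn_of_image_mem_nhds hGinvmono (Ici_mem_nhds hz) ?_
    exact mem_of_superset (Ici_mem_nhds hlt) fun y hy =>
      ⟨_, integral_one_div_mul_gauge_nonneg hg1 hy, hGinv₁ y hy⟩
  have hpos : 0 < Ginv z * g (Ginv z) :=
    mul_pos (by linarith) (by linarith [hg1 _ hlt.le])
  have h := (hasDerivAt_integral_one_div_mul_gauge hgc hg1 hlt).of_local_left_inverse hcont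
    (one_div_pos.2 hpos).ne' (by
      filter_upwards [Ici_mem_nhds hz] with w hw using hGinv₂ w hw)
  simpa only [one_div, inv_inv] using h

/-- **A priori bound for first-order ODE solutions (key estimate in Wintner's theorem).**
Let `g` be a gauge function with `G(y) = ∫₁^y dx/(x g(x)) → +∞` and inverse
`G⁻¹ : [0,∞) → [1,∞)`. If `ν` is continuous with `‖ν(t,q)‖ ≤ g(1+‖q‖)(1+‖q‖)` on
`[t₀,t₁] × ℝⁿ` and `q` is a `C¹` solution of `q̇ = ν(t,q)` on `[t₀,t₁]`, then
`1 + ‖q(t)‖ ≤ G⁻¹(G(1 + ‖q(t₀)‖) + (t - t₀))` on `[t₀,t₁]`; in particular `q`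
is bounded on `[t₀,t₁]`. -/
theorem wintner_apriori_bound {n : ℕ} (g Ginv : ℝ → ℝ) (t₀ t₁ : ℝ) (ht : t₀ ≤ t₁)
    (hgc : ContinuousOn g (Ici 1)) (hgm : MonotoneOn g (Ici 1))
    (hg1 : ∀ x ∈ Ici (1:ℝ), 1 ≤ g x)
    (hdiv : Tendsto (fun y => ∫ x in (1:ℝ)..y, 1 / (x * g x)) atTop atTop)
    (hGinvmap : Set.MapsTo Ginv (Ici 0) (Ici 1))
    (hGinvmono : MonotoneOn Ginv (Ici 0))
    (hGinv₁ : ∀ y ∈ Ici (1:ℝ), Ginv (∫ x in (1:ℝ)..y, 1 / (x * g x)) = y)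
    (hGinv₂ : ∀ z ∈ Ici (0:ℝ), (∫ x in (1:ℝ)..(Ginv z), 1 / (x * g x)) = z)
    (ν : ℝ → EuclideanSpace ℝ (Fin n) → EuclideanSpace ℝ (Fin n))
    (hν : Continuous fun p : ℝ × EuclideanSpace ℝ (Fin n) => ν p.1 p.2)
    (hbound : ∀ t ∈ Icc t₀ t₁, ∀ x : EuclideanSpace ℝ (Fin n),
      ‖ν t x‖ ≤ g (1 + ‖x‖) * (1 + ‖x‖))
    (q : ℝ → EuclideanSpace ℝ (Fin n))
    (hq : ∀ t ∈ Icc t₀ t₁, HasDerivWithinAt q (ν t (q t)) (Icc t₀ t₁) t) :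
    (∀ t ∈ Icc t₀ t₁,
      1 + ‖q t‖ ≤ Ginv ((∫ x in (1:ℝ)..(1 + ‖q t₀‖), 1 / (x * g x)) + (t - t₀))) ∧
    ∃ C : ℝ, ∀ t ∈ Icc t₀ t₁, ‖q t‖ ≤ C := by
  set G : ℝ → ℝ := fun y => ∫ x in (1 : ℝ)..y, 1 / (x * g x)
  have hone : ∀ v : EuclideanSpace ℝ (Fin n), 1 ≤ 1 + ‖v‖ := fun v => by
    linarith [norm_nonneg v]
  have hGnn : ∀ v : EuclideanSpace ℝ (Fin n), 0 ≤ G (1 + ‖v‖) := fun v =>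
    integral_one_div_mul_gauge_nonneg hg1 (hone v)
  have hbarrier : ∀ ε > 0, ∀ t ∈ Icc t₀ t₁,
      ‖q t‖ ≤ Ginv (G (1 + ‖q t₀‖) + ε + (1 + ε) * (t - t₀)) - 1 := by
    intro ε hε
    have hpos : ∀ t, t₀ ≤ t → 0 < G (1 + ‖q t₀‖) + ε + (1 + ε) * (t - t₀) := fun t h => by
      have := mul_nonneg (by linarith : 0 ≤ 1 + ε) (sub_nonneg.2 h)
      linarith [hGnn (q t₀)]
    have hderiv : ∀ t, t₀ ≤ t → HasDerivAt
        (fun t => Ginv (G (1 + ‖q t₀‖) + ε + (1 + ε) * (t - t₀)) - 1)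
        (Ginv (G (1 + ‖q t₀‖) + ε + (1 + ε) * (t - t₀)) *
          g (Ginv (G (1 + ‖q t₀‖) + ε + (1 + ε) * (t - t₀))) * (1 + ε)) t := fun t h => by
      have hlin : HasDerivAt (fun t => G (1 + ‖q t₀‖) + ε + (1 + ε) * (t - t₀)) (1 + ε) t := by
        simpa using (((hasDerivAt_id t).sub_const t₀).const_mul (1 + ε)).const_add
          (G (1 + ‖q t₀‖) + ε)
      exact ((hasDerivAt_inverse_integral_gauge hgc hg1 hGinvmap hGinvmono hGinv₁ hGinv₂
        (hpos t h)).comp t hlin).sub_const 1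
    intro t ht
    refine image_norm_le_of_norm_deriv_right_lt_deriv_boundary'
      (fun t ht => (hq t ht).continuousWithinAt)
      (fun t ht => (hq t (Ico_subset_Icc_self ht)).mono_of_mem_nhdsWithin
        (Icc_mem_nhdsGE_of_mem ht)) ?_
      (fun t ht => (hderiv t ht.1).continuousAt.continuousWithinAt)
      (fun t ht => (hderiv t ht.1).hasDerivWithinAt) ?_ ht
    · have := hGinvmono (hGnn (q t₀)) (hpos t₀ le_rfl).le
        (by rw [sub_self]; linarith)
      rw [hGinv₁ _ (hone _)] at this
      linarith
    · intro t ht heq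
      have heq' : Ginv (G (1 + ‖q t₀‖) + ε + (1 + ε) * (t - t₀)) = 1 + ‖q t‖ := by linarith
      rw [heq']
      have hp : 0 < g (1 + ‖q t‖) * (1 + ‖q t‖) :=
        mul_pos (by linarith [hg1 _ (hone (q t))]) (by linarith [hone (q t)])
      have := hbound t (Ico_subset_Icc_self ht) (q t)
      nlinarith [mul_pos hp hε]
  have hGle : ∀ t ∈ Icc t₀ t₁, G (1 + ‖q t‖) ≤ G (1 + ‖q t₀‖) + (t - t₀) := by
    intro t ht
    have hs : 0 ≤ t - t₀ := sub_nonneg.2 ht.1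
    refine le_of_forall_pos_le_add fun δ hδ => ?_
    set ε := δ / (1 + (t - t₀))
    have hε : 0 < ε := by positivity
    have hεδ : ε * (1 + (t - t₀)) = δ := div_mul_cancel₀ _ (by positivity)
    have hw : G (1 + ‖q t₀‖) + ε + (1 + ε) * (t - t₀) = G (1 + ‖q t₀‖) + (t - t₀) + δ := by
      rw [← hεδ]; ring
    have hle := hbarrier ε hε t ht
    rw [hw] at hle
    have hwnn : 0 ≤ G (1 + ‖q t₀‖) + (t - t₀) + δ := by linarith [hGnn (q t₀)]
    by_contra! hlt
    have hge := hGinvmono hwnn (hGnn (q t)) hlt.le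
    rw [hGinv₁ _ (hone _)] at hge
    have heq : Ginv (G (1 + ‖q t₀‖) + (t - t₀) + δ) = 1 + ‖q t‖ := by linarith
    have := hGinv₂ _ hwnn
    rw [heq] at this
    exact hlt.ne' this
  have hmain : ∀ t ∈ Icc t₀ t₁, 1 + ‖q t‖ ≤ Ginv (G (1 + ‖q t₀‖) + (t - t₀)) := by
    intro t ht
    have := hGinvmono (hGnn (q t)) ((hGnn (q t)).trans (hGle t ht)) (hGle t ht)
    rwa [hGinv₁ _ (hone _)] at this
  have hnn : ∀ t ∈ Icc t₀ t₁, 0 ≤ G (1 + ‖q t₀‖) + (t - t₀) := fun t ht =>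
    (hGnn (q t)).trans (hGle t ht)
  refine ⟨hmain, Ginv (G (1 + ‖q t₀‖) + (t₁ - t₀)), fun t ht' => ?_⟩
  have := hGinvmono (hnn t ht') (hnn t₁ (right_mem_Icc.2 ht)) (by linarith [ht'.2])
  linarith [hmain t ht']
end

section
/- Let g : [1,∞) → [1,∞) be continuous and non-decreasing, let K > 0, let f : ℝ × ℝⁿ × ℝⁿ → ℝⁿ be continuous, and for each t let F_t : ℝⁿ → ℝⁿ be a linear map, continuous in t, which is antisymmetric (⟨F_t v, v⟩ = 0 for all v). Define E(t,q,v) := 1 + ‖q‖² + ‖v‖², and suppose ‖f(t,q,v) − F_t v‖ ≤ g(E(t,q,v)) · E(t,q,v) / (K + ‖v‖) for all (t,q,v). Let q : I → ℝⁿ be a C² solution of q̈(t) = f(t, q(t), q̇(t)) on an interval I, and set E(t) := 1 + ‖q(t)‖² + ‖q̇(t)‖². Then for all t₁, t₂ ∈ I with t₁ < t₂ one has |E(t₂) − E(t₁)| ≤ 6 ∫_{t₁}^{t₂} g(E(s)) E(s) ds. -/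
open Set Filter MeasureTheory
open scoped RealInnerProductSpace

/-- If `w` is orthogonal to `v` and the force `a` deviates from `w` by at most
`G * (1 + ‖x‖² + ‖v‖²) / (K + ‖v‖)`, then the energy changes at a rate of at most
`3 * G * (1 + ‖x‖² + ‖v‖²)`. -/
theorem abs_energy_rate_le {V : Type*} [NormedAddCommGroup V] [InnerProductSpace ℝ V]
    {x v a w : V} {G K : ℝ} (hG : 1 ≤ G) (hK : 0 < K) (hw : ⟪w, v⟫ = 0)
    (h : ‖a - w‖ ≤ G * (1 + ‖x‖ ^ 2 + ‖v‖ ^ 2) / (K + ‖v‖)) :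
    |2 * ⟪x, v⟫ + 2 * ⟪v, a⟫| ≤ 3 * (G * (1 + ‖x‖ ^ 2 + ‖v‖ ^ 2)) := by
  set E := 1 + ‖x‖ ^ 2 + ‖v‖ ^ 2 with hE
  have hE0 : 0 ≤ E := by positivity
  have hva : |⟪v, a⟫| ≤ G * E := by
    have hperp : ⟪v, a⟫ = ⟪v, a - w⟫ := by
      rw [inner_sub_right, real_inner_comm w v, hw, sub_zero]
    calc |⟪v, a⟫| ≤ ‖v‖ * ‖a - w‖ := hperp ▸ abs_real_inner_le_norm _ _
      _ ≤ (K + ‖v‖) * ‖a - w‖ := by gcongr; linarith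
      _ ≤ G * E := (le_div_iff₀' (by positivity)).1 h
  have hxv : 2 * |⟪x, v⟫| ≤ E := by
    nlinarith [abs_real_inner_le_norm x v, sq_nonneg (‖x‖ - ‖v‖)]
  have hEG : E ≤ G * E := le_mul_of_one_le_left hE0 hG
  calc |2 * ⟪x, v⟫ + 2 * ⟪v, a⟫| ≤ |2 * ⟪x, v⟫| + |2 * ⟪v, a⟫| := abs_add_le _ _
    _ = 2 * |⟪x, v⟫| + 2 * |⟪v, a⟫| := by simp [abs_mul]
    _ ≤ 3 * (G * E) := by linarith

/-- **Two-sided energy estimate for second-order ODEs (Euclidean case).**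
Let `g : [1,∞) → [1,∞)` be continuous non-decreasing, `K > 0`, `f` continuous,
`F_t` a continuous family of antisymmetric linear maps, `E(t,q,v) = 1+‖q‖²+‖v‖²`,
and suppose `‖f(t,q,v) - F_t v‖ ≤ g(E) E/(K+‖v‖)`. If `q` is a `C²` solution of
`q̈ = f(t,q,q̇)` on an interval `I`, then with `E(s) = 1+‖q(s)‖²+‖q̇(s)‖²`,
`|E(t₂) - E(t₁)| ≤ 6 ∫_{t₁}^{t₂} g(E(s)) E(s) ds` for all `t₁ < t₂` in `I`. -/
theorem second_order_energy_estimate {n : ℕ}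
    (g : ℝ → ℝ) (K : ℝ) (hK : 0 < K)
    (hgc : ContinuousOn g (Ici 1)) (hgm : MonotoneOn g (Ici 1))
    (hg1 : ∀ x ∈ Ici (1:ℝ), 1 ≤ g x)
    (f : ℝ → EuclideanSpace ℝ (Fin n) → EuclideanSpace ℝ (Fin n) → EuclideanSpace ℝ (Fin n))
    (hf : Continuous fun p : ℝ × EuclideanSpace ℝ (Fin n) × EuclideanSpace ℝ (Fin n) =>
      f p.1 p.2.1 p.2.2)
    (F : ℝ → EuclideanSpace ℝ (Fin n) →L[ℝ] EuclideanSpace ℝ (Fin n))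
    (hFc : Continuous F)
    (hFanti : ∀ (t : ℝ) (v : EuclideanSpace ℝ (Fin n)), ⟪F t v, v⟫ = 0)
    (hbound : ∀ (t : ℝ) (x v : EuclideanSpace ℝ (Fin n)),
      ‖f t x v - F t v‖ ≤
        g (1 + ‖x‖ ^ 2 + ‖v‖ ^ 2) * (1 + ‖x‖ ^ 2 + ‖v‖ ^ 2) / (K + ‖v‖))
    (I : Set ℝ) (hI : I.OrdConnected)
    (q q' : ℝ → EuclideanSpace ℝ (Fin n))
    (hq : ∀ t ∈ I, HasDerivWithinAt q (q' t) I t ∧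
      HasDerivWithinAt q' (f t (q t) (q' t)) I t) :
    ∀ t₁ ∈ I, ∀ t₂ ∈ I, t₁ < t₂ →
      |(1 + ‖q t₂‖ ^ 2 + ‖q' t₂‖ ^ 2) - (1 + ‖q t₁‖ ^ 2 + ‖q' t₁‖ ^ 2)| ≤
        6 * ∫ s in t₁..t₂,
          g (1 + ‖q s‖ ^ 2 + ‖q' s‖ ^ 2) * (1 + ‖q s‖ ^ 2 + ‖q' s‖ ^ 2) := by
  intro t₁ ht₁ t₂ ht₂ hlt
  have hsub : Icc t₁ t₂ ⊆ I := hI.out ht₁ ht₂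
  have hE1 (x v : EuclideanSpace ℝ (Fin n)) : 1 + ‖x‖ ^ 2 + ‖v‖ ^ 2 ∈ Ici (1 : ℝ) := by
    rw [mem_Ici, add_assoc]
    exact le_add_of_nonneg_right (by positivity)
  have hqc : ContinuousOn q (Icc t₁ t₂) := fun t ht =>
    (hq t (hsub ht)).1.continuousWithinAt.mono hsub
  have hqc' : ContinuousOn q' (Icc t₁ t₂) := fun t ht =>
    (hq t (hsub ht)).2.continuousWithinAt.mono hsub
  have hEc : ContinuousOn (fun s => 1 + ‖q s‖ ^ 2 + ‖q' s‖ ^ 2) (Icc t₁ t₂) :=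
    (continuousOn_const.add (hqc.norm.pow 2)).add (hqc'.norm.pow 2)
  have hfc : ContinuousOn (fun s => f s (q s) (q' s)) (Icc t₁ t₂) :=
    hf.comp_continuousOn (continuousOn_id.prodMk (hqc.prodMk hqc'))
  have hratec : ContinuousOn
      (fun s => 2 * ⟪q s, q' s⟫ + 2 * ⟪q' s, f s (q s) (q' s)⟫) (Icc t₁ t₂) :=
    (continuousOn_const.mul (hqc.inner hqc')).add (continuousOn_const.mul (hqc'.inner hfc))
  have hderiv : ∀ t ∈ Ioo t₁ t₂, HasDerivAt (fun s => 1 + ‖q s‖ ^ 2 + ‖q' s‖ ^ 2)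
      (2 * ⟪q t, q' t⟫ + 2 * ⟪q' t, f t (q t) (q' t)⟫) t := by
    intro t ht
    have hnhds : I ∈ nhds t := mem_of_superset (Icc_mem_nhds ht.1 ht.2) hsub
    obtain ⟨h₁, h₂⟩ := hq t (hsub (Ioo_subset_Icc_self ht))
    exact ((h₁.hasDerivAt hnhds).norm_sq.const_add 1).add (h₂.hasDerivAt hnhds).norm_sq
  have hgEc : ContinuousOn (fun s => g (1 + ‖q s‖ ^ 2 + ‖q' s‖ ^ 2) *
      (1 + ‖q s‖ ^ 2 + ‖q' s‖ ^ 2)) (Icc t₁ t₂) :=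
    (hgc.comp hEc fun s _ => hE1 (q s) (q' s)).mul hEc
  rw [← intervalIntegral.integral_eq_sub_of_hasDerivAt_of_le hlt.le hEc hderiv
    (hratec.intervalIntegrable_of_Icc hlt.le), ← intervalIntegral.integral_const_mul,
    ← Real.norm_eq_abs]
  refine intervalIntegral.norm_integral_le_of_norm_le hlt.le (ae_of_all _ fun t _ => ?_)
    ((continuousOn_const.mul hgEc).intervalIntegrable_of_Icc hlt.le)
  have hg := hg1 _ (hE1 (q t) (q' t))
  refine (abs_energy_rate_le hg hK (hFanti t (q' t)) (hbound t (q t) (q' t))).trans ?_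
  gcongr
  norm_num
end

section
/- Let b : ℝ × ℝⁿ → ℝⁿ and V : ℝ × ℝⁿ → ℝ be C², and consider the Lagrangian L(t,q,v) = ½‖v‖² + ⟨b(t,q), v⟩ − V(t,q) on ℝ × ℝⁿ × ℝⁿ. Its Euler–Lagrange equations read, in components, q̈ᵢ = Σⱼ (∂bⱼ/∂qᵢ − ∂bᵢ/∂qⱼ)(t,q) q̇ⱼ − (∂bᵢ/∂t)(t,q) − (∂V/∂qᵢ)(t,q). Suppose that for every r > 0 there is a continuous non-decreasing function g_r : [1,∞) → [1,∞) with ∫₁^∞ dx/(x g_r(x)) = +∞ such that ‖(∂_t b)(t,q)‖ ≤ g_r(1 + ‖q‖²)·(1 + ‖q‖) and ‖(∇_q V)(t,q)‖ ≤ g_r(1 + ‖q‖²)·(1 + ‖q‖) for every (t,q) ∈ [−r,r] × ℝⁿ. Then every maximal solution of these Euler–Lagrange equations is defined on all of ℝ. -/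
open Set Filter MeasureTheory

/-- The Euler–Lagrange force of the Lagrangian
`L(t,q,v) = ½‖v‖² + ⟨b(t,q), v⟩ - V(t,q)`, whose `i`-th component is
`Σⱼ (∂bⱼ/∂qᵢ - ∂bᵢ/∂qⱼ)(t,q) vⱼ - (∂bᵢ/∂t)(t,q) - (∂V/∂qᵢ)(t,q)`,
so that the Euler–Lagrange equations read `q̈ = elForce b V t q q̇`. -/
noncomputable def elForce {n : ℕ}
    (b : ℝ → EuclideanSpace ℝ (Fin n) → EuclideanSpace ℝ (Fin n))
    (V : ℝ → EuclideanSpace ℝ (Fin n) → ℝ)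
    (t : ℝ) (x v : EuclideanSpace ℝ (Fin n)) : EuclideanSpace ℝ (Fin n) :=
  (WithLp.equiv 2 (Fin n → ℝ)).symm fun i =>
    (∑ j, (fderiv ℝ (fun y => b t y j) x (EuclideanSpace.single i 1)
          - fderiv ℝ (fun y => b t y i) x (EuclideanSpace.single j 1)) * v j)
    - deriv (fun s => b s x) t i
    - fderiv ℝ (fun y => V t y) x (EuclideanSpace.single i 1)

/-- A solution of the Euler–Lagrange equations on a nonempty interval `I ⊆ ℝ`,
recorded together with its velocity `q'`. -/
def IsSolutionEL {n : ℕ}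
    (b : ℝ → EuclideanSpace ℝ (Fin n) → EuclideanSpace ℝ (Fin n))
    (V : ℝ → EuclideanSpace ℝ (Fin n) → ℝ)
    (I : Set ℝ) (q q' : ℝ → EuclideanSpace ℝ (Fin n)) : Prop :=
  I.Nonempty ∧ I.OrdConnected ∧ ∀ t ∈ I,
    HasDerivWithinAt q (q' t) I t ∧
    HasDerivWithinAt q' (elForce b V t (q t) (q' t)) I t

/-- A maximal solution: a solution admitting no extension to a solution on a
strictly larger interval. -/
def IsMaximalSolutionEL {n : ℕ}
    (b : ℝ → EuclideanSpace ℝ (Fin n) → EuclideanSpace ℝ (Fin n))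
    (V : ℝ → EuclideanSpace ℝ (Fin n) → ℝ)
    (I : Set ℝ) (q q' : ℝ → EuclideanSpace ℝ (Fin n)) : Prop :=
  IsSolutionEL b V I q q' ∧
    ∀ J r r', IsSolutionEL b V J r r' → I ⊆ J → Set.EqOn q r I → Set.EqOn q' r' I → J = I

open scoped Topology

section FirstOrder

variable {E : Type*} [NormedAddCommGroup E] [NormedSpace ℝ E]

/-- A solution of the first-order equation `y' = F t y` on the set `I`. -/
def IsODESolutionOn (F : ℝ → E → E) (I : Set ℝ) (y : ℝ → E) : Prop :=
  ∀ t ∈ I, HasDerivWithinAt y (F t (y t)) I t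

/-- The equation `y' = F t y` becomes `z' = -F (-t) z` under time reversal. -/
theorem IsODESolutionOn.comp_neg {F : ℝ → E → E} {I : Set ℝ} {y : ℝ → E}
    (h : IsODESolutionOn F I y) :
    IsODESolutionOn (fun t x => -F (-t) x) (Neg.neg ⁻¹' I) (fun t => y (-t)) := by
  intro t ht
  have := (h (-t) ht).scomp t (hasDerivAt_neg t).hasDerivWithinAt (s := Neg.neg ⁻¹' I)
    (fun x hx => hx)
  simpa [Function.comp_def] using this

theorem exists_local_solution_of_contDiff [CompleteSpace E] {F : ℝ → E → E}
    (hF : ContDiff ℝ 1 fun p : ℝ × E => F p.1 p.2) (s : ℝ) (x : E) :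
    ∃ α : ℝ → E, α s = x ∧ ∃ ε > (0 : ℝ), ∀ t ∈ Ioo (s - ε) (s + ε),
      HasDerivAt α (F t (α t)) t := by
  have hG : ContDiff ℝ 1 fun p : ℝ × E => ((1 : ℝ), F p.1 p.2) := contDiff_const.prodMk hF
  obtain ⟨α, hα, ε, hε, h⟩ :=
    (hG.contDiffAt (x := (s, x))).exists_forall_mem_closedBall_exists_eq_forall_mem_Ioo_hasDerivAt₀ s
  have hs : s ∈ Ioo (s - ε) (s + ε) := ⟨by linarith, by linarith⟩
  have hfst : ∀ t ∈ Ioo (s - ε) (s + ε), (α t).1 = t := by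
    intro t ht
    have hd : ∀ u ∈ Ioo (s - ε) (s + ε),
        HasDerivWithinAt (fun u => (α u).1 - u) 0 (Ioo (s - ε) (s + ε)) u := by
      intro u hu
      have h1 : HasDerivAt (fun u => (α u).1) 1 u := by
        simpa using (h u hu).hasFDerivAt.fst.hasDerivAt
      have h2 := (h1.sub (hasDerivAt_id' u)).hasDerivWithinAt (s := Ioo (s - ε) (s + ε))
      rw [sub_self] at h2
      exact h2
    have := (convex_Ioo (s - ε) (s + ε)).norm_image_sub_le_of_norm_hasDerivWithin_le hd
      (C := 0) (by simp) hs ht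
    have h0 : (α s).1 = s := by rw [hα]
    simp only [h0, sub_self, sub_zero, zero_mul, norm_le_zero_iff] at this
    linarith
  refine ⟨fun t => (α t).2, by simp [hα], ε, hε, fun t ht => ?_⟩
  have := (h t ht).hasFDerivAt.snd.hasDerivAt
  simpa [hfst t ht] using this

/-- A solution on an interval with a largest element can be continued to the right. -/
theorem IsODESolutionOn.exists_extension_of_isGreatest [CompleteSpace E] {F : ℝ → E → E}
    (hF : ContDiff ℝ 1 fun p : ℝ × E => F p.1 p.2) {I : Set ℝ} {y : ℝ → E} (hI : I.OrdConnected)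
    (hy : IsODESolutionOn F I y) {s : ℝ} (hs : IsGreatest I s) :
    ∃ J z, J.OrdConnected ∧ IsODESolutionOn F J z ∧ I ⊂ J ∧ EqOn y z I := by
  obtain ⟨α, hα, ε, hε, h⟩ := exists_local_solution_of_contDiff hF s (y s)
  set z : ℝ → E := fun t => if t ≤ s then y t else α t with hz
  have hzI : ∀ t ≤ s, z t = y t := fun t ht => by simp [hz, ht]
  have hzα : ∀ t, s ≤ t → z t = α t := fun t ht => by
    rcases ht.eq_or_lt with rfl | h'
    · simp [hz, hα]
    · simp [hz, h']
  have hle : ∀ t ∈ I, t ≤ s := fun t ht => hs.2 ht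
  refine ⟨I ∪ Ico s (s + ε), z, ⟨?_⟩, ?_, ?_, fun t ht => (hzI t (hle t ht)).symm⟩
  · rintro a (ha | ha) c (hc | hc) u hu
    · exact Or.inl (hI.out ha hc hu)
    · rcases le_total u s with hus | hus
      · exact Or.inl (hI.out ha hs.1 ⟨hu.1, hus⟩)
      · exact Or.inr ⟨hus, hu.2.trans_lt hc.2⟩
    · exact Or.inl (hI.out hs.1 hc ⟨ha.1.trans hu.1, hu.2⟩)
    · exact Or.inr ⟨ha.1.trans hu.1, hu.2.trans_lt hc.2⟩
  · intro t ht
    have hleft : t ≤ s → t ∈ I := by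
      rintro h'
      rcases ht with ht | ht
      · exact ht
      · rw [le_antisymm h' ht.1]; exact hs.1
    have key1 : t ≤ s → HasDerivWithinAt z (F t (z t)) I t := fun h' => by
      rw [hzI t h']
      exact (hy t (hleft h')).congr (fun u hu => hzI u (hle u hu)) (hzI t h')
    have key2 : s ≤ t → HasDerivWithinAt z (F t (z t)) (Ico s (s + ε)) t := fun h' => by
      have htε : t < s + ε := by
        rcases ht with ht | ht
        · linarith [hle t ht]
        · exact ht.2
      rw [hzα t h']
      exact (h t ⟨by linarith, htε⟩).hasDerivWithinAt.congr (fun u hu => hzα u hu.1) (hzα t h')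
    rcases lt_trichotomy t s with h' | h' | h'
    · refine (key1 h'.le).mono_of_mem_nhdsWithin ?_
      filter_upwards [self_mem_nhdsWithin, mem_nhdsWithin_of_mem_nhds (Iio_mem_nhds h')] with u hu hu'
      exact hu.resolve_right fun h'' => absurd h''.1 (not_le.2 hu')
    · exact (key1 h'.le).union (key2 h'.ge)
    · refine (key2 h'.le).mono_of_mem_nhdsWithin ?_
      filter_upwards [self_mem_nhdsWithin, mem_nhdsWithin_of_mem_nhds (Ioi_mem_nhds h')] with u hu hu'
      exact hu.resolve_left fun h'' => absurd (hle u h'') (not_le.2 hu')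
  · refine ⟨subset_union_left, fun hsub => ?_⟩
    have := hle (s + ε / 2) (hsub (Or.inr ⟨by linarith, by linarith⟩))
    linarith

/-- A bounded solution on an interval extends to the finite supremum of that interval. -/
theorem IsODESolutionOn.exists_extension_of_isLUB [FiniteDimensional ℝ E] {F : ℝ → E → E}
    (hF : Continuous fun p : ℝ × E => F p.1 p.2) {I : Set ℝ} {y : ℝ → E} (hI : I.OrdConnected)
    (hy : IsODESolutionOn F I y) {s t₀ R : ℝ} (hs : IsLUB I s) (hsI : s ∉ I) (ht₀ : t₀ ∈ I)
    (hR : ∀ t ∈ I, t₀ ≤ t → ‖y t‖ ≤ R) :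
    ∃ J z, J.OrdConnected ∧ IsODESolutionOn F J z ∧ I ⊂ J ∧ EqOn y z I := by
  have : ProperSpace E := FiniteDimensional.proper ℝ E
  have : CompleteSpace E := FiniteDimensional.complete ℝ E
  have hlt : ∀ t ∈ I, t < s := fun t ht => (hs.1 ht).lt_of_ne fun h => hsI (h ▸ ht)
  have hsub : Ico t₀ s ⊆ I := fun t ht => by
    obtain ⟨u, hu, htu⟩ := (lt_isLUB_iff hs).1 ht.2
    exact hI.out ht₀ hu ⟨ht.1, htu.le⟩
  have hderiv : ∀ t ∈ Ioo t₀ s, HasDerivAt y (F t (y t)) t := fun t ht =>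
    ((hy t (hsub ⟨ht.1.le, ht.2⟩)).mono hsub).hasDerivAt (Ico_mem_nhds ht.1 ht.2)
  obtain ⟨C, hC⟩ := ((isCompact_Icc (a := t₀) (b := s)).prod
    (isCompact_closedBall (0 : E) R)).exists_bound_of_continuousOn hF.continuousOn
  have hC' : ∀ t ∈ Ico t₀ s, ‖F t (y t)‖ ≤ C := fun t ht =>
    hC (t, y t) ⟨⟨ht.1, ht.2.le⟩, by simpa using hR t (hsub ht) ht.1⟩
  have hLip : LipschitzOnWith C.toNNReal y (Ico t₀ s) :=
    (convex_Ico t₀ s).lipschitzOnWith_of_nnnorm_hasDerivWithin_le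
      (fun t ht => (hy t (hsub ht)).mono hsub)
      (fun t ht => by
        rw [← NNReal.coe_le_coe]; exact (hC' t ht).trans (Real.le_coe_toNNReal C))
  have hmem : Ioo t₀ s ∈ 𝓝[<] s := Ioo_mem_nhdsLT (hlt t₀ ht₀)
  have hcauchy : Cauchy (map y (𝓝[<] s)) :=
    ((cauchy_nhds (a := s)).mono nhdsWithin_le_nhds).map_of_le hLip.uniformContinuousOn
      (le_principal_iff.2 (mem_of_superset hmem Ioo_subset_Ico_self))
  obtain ⟨l, hl⟩ := CompleteSpace.complete hcauchy
  have hl : Tendsto y (𝓝[<] s) (𝓝 l) := hl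
  set z : ℝ → E := Function.update y s l with hz
  have hzs : z s = l := by simp [hz]
  have hzy : ∀ t, t ≠ s → z t = y t := fun t ht => by simp [hz, ht]
  have hzderiv : ∀ t ∈ Ioo t₀ s, HasDerivAt z (F t (y t)) t := fun t ht =>
    (hderiv t ht).congr_of_eventuallyEq (by
      filter_upwards [Iio_mem_nhds ht.2] with u hu using hzy u (ne_of_lt hu))
  have hzl : Tendsto z (𝓝[<] s) (𝓝 l) := hl.congr' (by
    filter_upwards [self_mem_nhdsWithin] with u hu using (hzy u (ne_of_lt hu)).symm)
  refine ⟨insert s I, z, ⟨?_⟩, ?_, ⟨subset_insert s I, fun h => hsI (h (mem_insert s I))⟩,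
    fun t ht => (hzy t (hlt t ht).ne).symm⟩
  · have hins : ∀ a ∈ insert s I, a ≤ s := by
      rintro a (rfl | ha)
      · exact le_rfl
      · exact (hlt a ha).le
    intro a ha c hc u hu
    rcases (hu.2.trans (hins c hc)).eq_or_lt with rfl | hus
    · exact Or.inl rfl
    · have haI : a ∈ I := ha.resolve_left (hu.1.trans_lt hus).ne
      obtain ⟨w, hw, huw⟩ := (lt_isLUB_iff hs).1 hus
      exact Or.inr (hI.out haI hw ⟨hu.1, huw.le⟩)
  · rintro t (rfl | ht)
    · have hF' : Tendsto (fun u => F u (y u)) (𝓝[<] t) (𝓝 (F t l)) :=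
        (hF.tendsto (t, l)).comp ((tendsto_id.mono_left nhdsWithin_le_nhds).prodMk_nhds hl)
      rw [hzs]
      refine (hasDerivWithinAt_Iic_of_tendsto_deriv (s := Ioo t₀ t)
        (fun u hu => (hzderiv u hu).differentiableAt.differentiableWithinAt) ?_ hmem
        (hF'.congr' ?_)).mono ?_
      · rw [ContinuousWithinAt, hzs]
        exact hzl.mono_left (nhdsWithin_mono _ fun u hu => hu.2)
      · filter_upwards [hmem] with u hu using (hzderiv u hu).deriv.symm
      · rintro u (rfl | hu)
        · exact mem_Iic.2 le_rfl
        · exact (hlt u hu).le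
    · have hts := hlt t ht
      rw [hzy t hts.ne]
      refine ((hy t ht).congr (fun u hu => hzy u (hlt u hu).ne)
        (hzy t hts.ne)).mono_of_mem_nhdsWithin ?_
      filter_upwards [self_mem_nhdsWithin, mem_nhdsWithin_of_mem_nhds (Iio_mem_nhds hts)]
        with u hu hu'
      exact hu.resolve_left (ne_of_lt hu')

/-- A solution that stays bounded in the future and whose interval has an upper bound outside it
can be continued to the right. -/
theorem IsODESolutionOn.exists_extension_right [FiniteDimensional ℝ E] {F : ℝ → E → E}
    (hF : ContDiff ℝ 1 fun p : ℝ × E => F p.1 p.2) {I : Set ℝ} {y : ℝ → E} (hI : I.OrdConnected)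
    (hy : IsODESolutionOn F I y) {t₀ R : ℝ} (hbdd : BddAbove I) (ht₀ : t₀ ∈ I)
    (hR : ∀ t ∈ I, t₀ ≤ t → ‖y t‖ ≤ R) :
    ∃ J z, J.OrdConnected ∧ IsODESolutionOn F J z ∧ I ⊂ J ∧ EqOn y z I := by
  have : CompleteSpace E := FiniteDimensional.complete ℝ E
  have hs : IsLUB I (sSup I) := isLUB_csSup ⟨t₀, ht₀⟩ hbdd
  by_cases hsI : sSup I ∈ I
  · exact hy.exists_extension_of_isGreatest hF hI ⟨hsI, hs.1⟩
  · exact hy.exists_extension_of_isLUB hF.continuous hI hs hsI ht₀ hR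

/-- A solution on an interval other than `ℝ` which is bounded on bounded time intervals admits a
proper extension. -/
theorem IsODESolutionOn.exists_extension [FiniteDimensional ℝ E] {F : ℝ → E → E}
    (hF : ContDiff ℝ 1 fun p : ℝ × E => F p.1 p.2) {I : Set ℝ} {y : ℝ → E} (hI : I.OrdConnected)
    (hne : I.Nonempty) (hy : IsODESolutionOn F I y) (huniv : I ≠ univ)
    (hR : ∀ r : ℝ, ∃ R, ∀ t ∈ I, |t| ≤ r → ‖y t‖ ≤ R) :
    ∃ J z, J.OrdConnected ∧ IsODESolutionOn F J z ∧ I ⊂ J ∧ EqOn y z I := by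
  obtain ⟨t₀, ht₀⟩ := hne
  obtain ⟨c, hc⟩ := (ne_univ_iff_exists_notMem I).1 huniv
  obtain ⟨R, hR⟩ := hR (max |t₀| |c|)
  rcases le_total t₀ c with h | h
  · have hle : ∀ t ∈ I, t ≤ c := fun t ht => le_of_not_ge fun h' => hc (hI.out ht₀ ht ⟨h, h'⟩)
    exact hy.exists_extension_right hF hI ⟨c, hle⟩ ht₀ fun t ht h' =>
      hR t ht (abs_le_max_abs_abs h' (hle t ht))
  · have hle : ∀ t ∈ I, c ≤ t := fun t ht => le_of_not_ge fun h' => hc (hI.out ht ht₀ ⟨h', h⟩)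
    have hF' : ContDiff ℝ 1 fun p : ℝ × E => -F (-p.1) p.2 :=
      (hF.comp (contDiff_fst.neg.prodMk contDiff_snd)).neg
    have hI' : (Neg.neg ⁻¹' I).OrdConnected :=
      ⟨fun a ha b hb u hu => hI.out hb ha ⟨neg_le_neg hu.2, neg_le_neg hu.1⟩⟩
    obtain ⟨J, z, hJ, hz, hIJ, hyz⟩ := hy.comp_neg.exists_extension_right hF' hI' (t₀ := -t₀)
      (R := R) ⟨-c, fun t ht => by linarith [hle _ ht]⟩ (by simpa using ht₀) (fun t ht h' =>
        hR _ ht ((abs_le_max_abs_abs (hle _ ht) (by linarith)).trans (max_comm _ _).le))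
    refine ⟨Neg.neg ⁻¹' J, fun t => z (-t),
      ⟨fun a ha b hb u hu => hJ.out hb ha ⟨neg_le_neg hu.2, neg_le_neg hu.1⟩⟩, ?_, ⟨?_, ?_⟩, ?_⟩
    · simpa using hz.comp_neg
    · exact fun t ht => hIJ.1 (by simpa using ht)
    · exact fun hsub => hIJ.2 fun t ht => hsub (by simpa using ht)
    · exact fun t ht => by simpa using hyz (x := -t) (by simpa using ht)

end FirstOrder

/-- Osgood's a priori bound: a function `W ≥ 1` on a bounded interval with
`|W'| ≤ C * (W * g W)`, where `∫ dx / (x * g x)` diverges, is bounded above. -/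
theorem exists_le_of_abs_deriv_le_gauge {g : ℝ → ℝ} (hg : ContinuousOn g (Ici 1))
    (hg1 : ∀ x ∈ Ici (1 : ℝ), 1 ≤ g x)
    (hgtop : Tendsto (fun y => ∫ x in (1 : ℝ)..y, 1 / (x * g x)) atTop atTop)
    {S : Set ℝ} (hS : Convex ℝ S) {r : ℝ} (hSr : S ⊆ Icc (-r) r) {W W' : ℝ → ℝ} {C : ℝ}
    (hW1 : ∀ t ∈ S, 1 ≤ W t) (hW : ∀ t ∈ S, HasDerivWithinAt W (W' t) S t)
    (hbound : ∀ t ∈ S, |W' t| ≤ C * (W t * g (W t))) :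
    ∃ R, ∀ t ∈ S, W t ≤ R := by
  rcases S.eq_empty_or_nonempty with rfl | ⟨t₀, ht₀⟩
  · exact ⟨0, by simp⟩
  set h : ℝ → ℝ := fun x => 1 / (max 1 x * g (max 1 x)) with hh
  have hpos : ∀ x ∈ Ici (1 : ℝ), 0 < x * g x := fun x hx =>
    mul_pos (zero_lt_one.trans_le hx) (zero_lt_one.trans_le (hg1 x hx))
  have hmax : Continuous fun x : ℝ => max 1 x := continuous_const.max continuous_id
  have hcont : Continuous h :=
    continuous_const.div (hmax.mul (hg.comp_continuous hmax fun x => mem_Ici.2 (le_max_left 1 x)))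
      fun x => (hpos _ (mem_Ici.2 (le_max_left 1 x))).ne'
  set Φ : ℝ → ℝ := fun y => ∫ x in (1 : ℝ)..y, h x with hΦ
  have hΦtop : Tendsto Φ atTop atTop := by
    refine hgtop.congr' ?_
    filter_upwards [eventually_ge_atTop 1] with y hy
    refine intervalIntegral.integral_congr fun x hx => ?_
    rw [uIcc_of_le hy] at hx
    simp [hh, max_eq_right hx.1]
  have hderiv : ∀ t ∈ S, HasDerivWithinAt (Φ ∘ W) (h (W t) * W' t) S t := fun t ht =>
    (hcont.integral_hasStrictDerivAt 1 (W t)).hasDerivAt.comp_hasDerivWithinAt t (hW t ht)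
  have hle : ∀ t ∈ S, ‖h (W t) * W' t‖ ≤ C := fun t ht => by
    have hp := hpos (W t) (hW1 t ht)
    simp only [hh, max_eq_right (hW1 t ht)]
    rw [Real.norm_eq_abs, abs_mul, abs_of_pos (by positivity), one_div, inv_mul_le_iff₀ hp]
    linarith [hbound t ht]
  have hC : 0 ≤ C := (norm_nonneg _).trans (hle t₀ ht₀)
  obtain ⟨Y, hY⟩ := eventually_atTop.1 (hΦtop.eventually_gt_atTop (Φ (W t₀) + C * (2 * r)))
  refine ⟨Y, fun t ht => le_of_not_ge fun hYt => absurd (hY _ hYt) (not_lt.2 ?_)⟩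
  have hmv := hS.norm_image_sub_le_of_norm_hasDerivWithin_le hderiv hle ht₀ ht
  have habs : ‖t - t₀‖ ≤ 2 * r := by
    rw [Real.norm_eq_abs, abs_le]
    constructor <;> linarith [(hSr ht).1, (hSr ht).2, (hSr ht₀).1, (hSr ht₀).2]
  have := (le_abs_self _).trans (hmv.trans (mul_le_mul_of_nonneg_left habs hC))
  simp only [Function.comp_apply] at this
  linarith

section Force

variable {n : ℕ} {b : ℝ → EuclideanSpace ℝ (Fin n) → EuclideanSpace ℝ (Fin n)}
  {V : ℝ → EuclideanSpace ℝ (Fin n) → ℝ}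

theorem contDiff_elForce
    (hb : ContDiff ℝ 2 fun p : ℝ × EuclideanSpace ℝ (Fin n) => b p.1 p.2)
    (hV : ContDiff ℝ 2 fun p : ℝ × EuclideanSpace ℝ (Fin n) => V p.1 p.2) :
    ContDiff ℝ 1 fun p : ℝ × EuclideanSpace ℝ (Fin n) × EuclideanSpace ℝ (Fin n) =>
      elForce b V p.1 p.2.1 p.2.2 := by
  have hbi : ∀ i, ContDiff ℝ 2 fun p : ℝ × EuclideanSpace ℝ (Fin n) => b p.1 p.2 i :=
    contDiff_euclidean.1 hb
  have hspace : ∀ (f : ℝ → EuclideanSpace ℝ (Fin n) → ℝ) (e : EuclideanSpace ℝ (Fin n)),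
      (ContDiff ℝ 2 fun p : ℝ × EuclideanSpace ℝ (Fin n) => f p.1 p.2) →
      ContDiff ℝ 1 fun p : ℝ × EuclideanSpace ℝ (Fin n) × EuclideanSpace ℝ (Fin n) =>
        fderiv ℝ (fun y => f p.1 y) p.2.1 e := by
    intro f e hf
    have h2 : ContDiff ℝ 2 (Function.uncurry
        fun (p : ℝ × EuclideanSpace ℝ (Fin n) × EuclideanSpace ℝ (Fin n)) y => f p.1 y) :=
      hf.comp ((contDiff_fst.comp contDiff_fst).prodMk contDiff_snd)
    exact (h2.fderiv (contDiff_fst.comp contDiff_snd) (by norm_num)).clm_apply contDiff_const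
  have htime : ∀ i, ContDiff ℝ 1
      fun p : ℝ × EuclideanSpace ℝ (Fin n) × EuclideanSpace ℝ (Fin n) =>
        deriv (fun s => b s p.2.1) p.1 i := by
    have h2 : ContDiff ℝ 2 (Function.uncurry
        fun (p : ℝ × EuclideanSpace ℝ (Fin n) × EuclideanSpace ℝ (Fin n)) s => b s p.2.1) :=
      hb.comp (contDiff_snd.prodMk (contDiff_fst.comp (contDiff_snd.comp contDiff_fst)))
    refine contDiff_euclidean.1 ?_
    simpa only [fderiv_apply_one_eq_deriv] using
      (h2.fderiv contDiff_fst (by norm_num)).clm_apply (contDiff_const (c := (1 : ℝ)))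
  refine contDiff_euclidean.2 fun i => ?_
  refine ((ContDiff.sum fun j _ => ?_).sub (htime i)).sub (hspace V _ hV)
  refine ((hspace (fun t y => b t y j) _ (hbi j)).sub
    (hspace (fun t y => b t y i) _ (hbi i))).mul ?_
  exact contDiff_euclidean.1 (contDiff_snd.comp contDiff_snd) j

/-- The magnetic part of the Euler–Lagrange force does no work. -/
theorem inner_elForce (t : ℝ) (x v : EuclideanSpace ℝ (Fin n)) :
    inner ℝ v (elForce b V t x v) =
      -inner ℝ v (deriv (fun s => b s x) t) - inner ℝ v (gradient (fun y => V t y) x) := by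
  have hgrad : ∀ i, gradient (fun y => V t y) x i =
      fderiv ℝ (fun y => V t y) x (EuclideanSpace.single i 1) := fun i => by
    rw [← inner_gradient_left, EuclideanSpace.inner_single_right]
    simp
  have hskew : ∀ A : Fin n → Fin n → ℝ, ∑ i, (∑ j, (A i j - A j i) * v j) * v i = 0 := by
    intro A
    have h1 : ∑ i, ∑ j, A i j * v j * v i = ∑ i, ∑ j, A j i * v j * v i := by
      rw [Finset.sum_comm]
      exact Finset.sum_congr rfl fun i _ => Finset.sum_congr rfl fun j _ => by ring
    simp only [Finset.sum_mul, sub_mul, Finset.sum_sub_distrib, h1, sub_self]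
  have := hskew fun i j => fderiv ℝ (fun y => b t y j) x (EuclideanSpace.single i 1)
  simp only [PiLp.inner_apply, hgrad, elForce, WithLp.equiv_symm_apply, RCLike.inner_apply,
    conj_trivial, sub_mul (_ - _), sub_mul (∑ _, _), Finset.sum_sub_distrib]
  rw [this]
  ring

theorem abs_inner_elForce_le {g : ℝ → ℝ} {t : ℝ} {x v : EuclideanSpace ℝ (Fin n)}
    (hb : ‖deriv (fun s => b s x) t‖ ≤ g (1 + ‖x‖ ^ 2) * (1 + ‖x‖))
    (hV : ‖gradient (fun y => V t y) x‖ ≤ g (1 + ‖x‖ ^ 2) * (1 + ‖x‖)) :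
    |inner ℝ v (elForce b V t x v)| ≤ 2 * g (1 + ‖x‖ ^ 2) * (‖v‖ * (1 + ‖x‖)) := by
  have h1 := (abs_real_inner_le_norm v (deriv (fun s => b s x) t)).trans
    (mul_le_mul_of_nonneg_left hb (norm_nonneg v))
  have h2 := (abs_real_inner_le_norm v (gradient (fun y => V t y) x)).trans
    (mul_le_mul_of_nonneg_left hV (norm_nonneg v))
  rw [inner_elForce]
  rw [abs_le] at *
  constructor <;> linarith [h1.1, h1.2, h2.1, h2.2]

/-- Under the gauge growth condition, solutions of the Euler–Lagrange equations are bounded in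
phase space on bounded time intervals. -/
theorem IsSolutionEL.exists_norm_le {I : Set ℝ} {q q' : ℝ → EuclideanSpace ℝ (Fin n)}
    (h : IsSolutionEL b V I q q') {r : ℝ} {g : ℝ → ℝ} (hg : ContinuousOn g (Ici 1))
    (hmono : MonotoneOn g (Ici 1)) (hg1 : ∀ x ∈ Ici (1 : ℝ), 1 ≤ g x)
    (hgtop : Tendsto (fun y => ∫ x in (1 : ℝ)..y, 1 / (x * g x)) atTop atTop)
    (hbound : ∀ t ∈ Icc (-r) r, ∀ x : EuclideanSpace ℝ (Fin n),
      ‖deriv (fun s => b s x) t‖ ≤ g (1 + ‖x‖ ^ 2) * (1 + ‖x‖) ∧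
      ‖gradient (fun y => V t y) x‖ ≤ g (1 + ‖x‖ ^ 2) * (1 + ‖x‖)) :
    ∃ R, ∀ t ∈ I, |t| ≤ r → ‖(q t, q' t)‖ ≤ R := by
  obtain ⟨-, hI, hsol⟩ := h
  have hderiv : ∀ t ∈ I ∩ Icc (-r) r,
      HasDerivWithinAt (fun t => 1 + ‖q t‖ ^ 2 + ‖q' t‖ ^ 2)
        (2 * inner ℝ (q t) (q' t) + 2 * inner ℝ (q' t) (elForce b V t (q t) (q' t)))
        (I ∩ Icc (-r) r) t := fun t ht =>
    (((hsol t ht.1).1.norm_sq.const_add 1).add (hsol t ht.1).2.norm_sq).mono inter_subset_left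
  obtain ⟨R, hR⟩ := exists_le_of_abs_deriv_le_gauge hg hg1 hgtop (C := 5)
    (hI.convex.inter (convex_Icc (-r) r)) inter_subset_right
    (fun t _ => by nlinarith [sq_nonneg ‖q t‖, sq_nonneg ‖q' t‖]) hderiv (by
      intro t ht
      have h1 := abs_inner_elForce_le (v := q' t) (hbound t ht.2 (q t)).1 (hbound t ht.2 (q t)).2
      have h2 := abs_real_inner_le_norm (q t) (q' t)
      set w := 1 + ‖q t‖ ^ 2 + ‖q' t‖ ^ 2 with hw
      have hw1 : (1 : ℝ) ≤ w := by nlinarith [sq_nonneg ‖q t‖, sq_nonneg ‖q' t‖]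
      have hgw := hg1 w hw1
      have hgle : g (1 + ‖q t‖ ^ 2) ≤ g w :=
        hmono (by simp) hw1 (by nlinarith [sq_nonneg ‖q' t‖])
      have h3 : ‖q' t‖ * (1 + ‖q t‖) ≤ w := by
        nlinarith [sq_nonneg (‖q t‖ - ‖q' t‖), sq_nonneg (‖q' t‖ - 1), sq_nonneg ‖q t‖]
      have h4 : 2 * (‖q t‖ * ‖q' t‖) ≤ w := by nlinarith [sq_nonneg (‖q t‖ - ‖q' t‖)]
      have h5 : g (1 + ‖q t‖ ^ 2) * (‖q' t‖ * (1 + ‖q t‖)) ≤ g w * w :=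
        mul_le_mul hgle h3 (by positivity) (by linarith)
      have h6 : w ≤ w * g w := le_mul_of_one_le_right (by linarith) hgw
      rw [abs_le] at *
      constructor <;> linarith [h1.1, h1.2, h2.1, h2.2])
  refine ⟨max R 0 + 1, fun t ht htr => ?_⟩
  have := hR t ⟨ht, abs_le.1 htr⟩
  have hR0 := le_max_left R 0
  rw [Prod.norm_def]
  refine max_le ?_ ?_ <;>
    nlinarith [sq_nonneg ‖q t‖, sq_nonneg ‖q' t‖, sq_nonneg (‖q t‖ - 1), sq_nonneg (‖q' t‖ - 1)]

end Force

/-- **Completeness of the Euler–Lagrange flow of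
`L(t,q,v) = ½‖v‖² + ⟨b(t,q), v⟩ - V(t,q)` on `ℝⁿ`.**
If `b, V` are `C²` and for every `r > 0` there is a gauge function `g_r` with
`‖∂_t b(t,q)‖ ≤ g_r(1+‖q‖²)(1+‖q‖)` and `‖∇_q V(t,q)‖ ≤ g_r(1+‖q‖²)(1+‖q‖)` on
`[-r,r] × ℝⁿ`, then every maximal solution of the Euler–Lagrange equations
`q̈ᵢ = Σⱼ (∂bⱼ/∂qᵢ - ∂bᵢ/∂qⱼ) q̇ⱼ - ∂bᵢ/∂t - ∂V/∂qᵢ` is defined on all of `ℝ`. -/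
theorem euler_lagrange_completeness {n : ℕ}
    (b : ℝ → EuclideanSpace ℝ (Fin n) → EuclideanSpace ℝ (Fin n))
    (V : ℝ → EuclideanSpace ℝ (Fin n) → ℝ)
    (hb : ContDiff ℝ 2 fun p : ℝ × EuclideanSpace ℝ (Fin n) => b p.1 p.2)
    (hV : ContDiff ℝ 2 fun p : ℝ × EuclideanSpace ℝ (Fin n) => V p.1 p.2)
    (hbound : ∀ r > (0:ℝ), ∃ g : ℝ → ℝ,
      ContinuousOn g (Ici 1) ∧ MonotoneOn g (Ici 1) ∧ (∀ x ∈ Ici (1:ℝ), 1 ≤ g x) ∧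
      Tendsto (fun y => ∫ x in (1:ℝ)..y, 1 / (x * g x)) atTop atTop ∧
      ∀ t ∈ Icc (-r) r, ∀ x : EuclideanSpace ℝ (Fin n),
        ‖deriv (fun s => b s x) t‖ ≤ g (1 + ‖x‖ ^ 2) * (1 + ‖x‖) ∧
        ‖gradient (fun y => V t y) x‖ ≤ g (1 + ‖x‖ ^ 2) * (1 + ‖x‖))
    (I : Set ℝ) (q q' : ℝ → EuclideanSpace ℝ (Fin n))
    (hq : IsMaximalSolutionEL b V I q q') : I = Set.univ := by
  by_contra huniv
  obtain ⟨hsol, hmax⟩ := hq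
  have hF : ContDiff ℝ 1 fun p : ℝ × EuclideanSpace ℝ (Fin n) × EuclideanSpace ℝ (Fin n) =>
      (p.2.2, elForce b V p.1 p.2.1 p.2.2) :=
    (contDiff_snd.comp contDiff_snd).prodMk (contDiff_elForce hb hV)
  have hODE : IsODESolutionOn (fun t (p : EuclideanSpace ℝ (Fin n) × EuclideanSpace ℝ (Fin n)) =>
      (p.2, elForce b V t p.1 p.2)) I fun t => (q t, q' t) := fun t ht =>
    (hsol.2.2 t ht).1.prodMk (hsol.2.2 t ht).2
  have hbdd : ∀ r : ℝ, ∃ R, ∀ t ∈ I, |t| ≤ r → ‖(q t, q' t)‖ ≤ R := by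
    intro r
    obtain ⟨g, hg, hmono, hg1, hgtop, hle⟩ := hbound (max r 1) (by positivity)
    obtain ⟨R, hR⟩ := hsol.exists_norm_le hg hmono hg1 hgtop hle
    exact ⟨R, fun t ht htr => hR t ht (htr.trans (le_max_left r 1))⟩
  obtain ⟨J, z, hJ, hz, hIJ, hyz⟩ := hODE.exists_extension hF hsol.2.1 hsol.1 huniv hbdd
  refine hIJ.ne' (hmax J (fun t => (z t).1) (fun t => (z t).2)
    ⟨hsol.1.mono hIJ.1, hJ, fun t ht => ?_⟩ hIJ.1
    (fun t ht => congrArg Prod.fst (hyz ht)) fun t ht => congrArg Prod.snd (hyz ht))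
  have := (hz t ht).hasFDerivWithinAt
  exact ⟨by simpa using this.fst.hasDerivWithinAt, by simpa using this.snd.hasDerivWithinAt⟩
end
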